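/- arXiv:2103.03016 — 4 statements merged into one kernel-verified Lean document; each statement's English description precedes it below -/
import Mathlib

section
/- Let (X,d,m) be a D-Ahlfors regular metric measure space (D > 0) and a ∈ (0,1]. There exists a constant C_a > 0 such that for every o ∈ X, every t ∈ (0,1/2], and every measurable nonnegative g : X → [0,∞) which is integrable on balls, there exists a finite collection {x_j}_{j∈J} of points of X such that, with d̄(x) = 1 + d(o,x): (1) t d̄(x_j) ≤ 1 for all j ∈ J; (2) ∑_{j∈J} 1_{B(x_j, t d̄(x_j))}(x) ≤ C_a for all x ∈ X; (3) ∑_{j∈J} 1_{B(x_j, a t d̄(x_j))}(x) ≥ 1 for every x ∈ X with t d̄(x) ≤ 1/2; (4) g(x_j) ≤ C_a · m(B(x_j, t d̄(x_j)))⁻¹ ∫_{B(x_j, t d̄(x_j))} g dm for all j ∈ J. -/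
open MeasureTheory Metric Set ENNReal

noncomputable section

variable {X : Type*} [MetricSpace X] [MeasurableSpace X] [BorelSpace X]

/-- `(X,d,m)` is `D`-Ahlfors regular: for some `A ≥ 1`,
`A⁻¹ r^D ≤ m(B(x,r)) ≤ A r^D` for all centres `x` and radii `r > 0`. -/
def AhlforsRegular (m : Measure X) (D : ℝ) : Prop :=
  ∃ A : ℝ, 1 ≤ A ∧ ∀ (x : X) (r : ℝ), 0 < r →
    ENNReal.ofReal (A⁻¹ * r ^ D) ≤ m (ball x r) ∧ m (ball x r) ≤ ENNReal.ofReal (A * r ^ D)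

/-- An approximation of the identity of exponent `γ` on a `D`-Ahlfors regular space. -/
def IsAI (D γ : ℝ) (K : ℝ → X → X → ℝ) : Prop :=
  Measurable (fun q : ℝ × X × X => K q.1 q.2.1 q.2.2) ∧
  (∀ t ∈ Ioc (0:ℝ) 1, ∀ x y : X, 0 ≤ K t x y) ∧
  ∃ c ∈ Ioo (0:ℝ) 1, ∀ t ∈ Ioc (0:ℝ) 1, ∀ x y z : X,
    4 * dist y z ≤ t + dist x y →
      K t x y ≤ t ^ (-D) * (1 + dist x y / t) ^ (-D - γ) ∧
      c * t ^ (-D) ≤ K t x x ∧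
      |K t x y - K t x z| ≤ t ^ (-D) * (dist y z / t) ^ γ * (1 + dist x y / t) ^ (-D - 2 * γ)

/-- The local radial maximal operator `K_* f(x) = sup_{0<t≤1} |K_t f(x)|`. -/
def maxOp (m : Measure X) (K : ℝ → X → X → ℝ) (f : X → ℝ) (x : X) : ℝ :=
  ⨆ t : Ioc (0:ℝ) 1, |∫ y, K t.1 x y * f y ∂m|

/-- Average of `f` over the set `B`. -/
def setAvg (m : Measure X) (B : Set X) (f : X → ℝ) : ℝ :=
  (m B).toReal⁻¹ * ∫ y in B, f y ∂m

/-- The centred Hardy–Littlewood maximal function. -/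
def hlMax (m : Measure X) (f : X → ℝ) (x : X) : ℝ :=
  ⨆ r : {r : ℝ // 0 < r}, setAvg m (ball x r.1) fun y => |f y|

/-- `φ` is a `γ`-Hölder cutoff on the ball `B(x,r)`. -/
def IsHolderCutoff (D γ : ℝ) (x : X) (r : ℝ) (φ : X → ℝ) : Prop :=
  (∀ y, y ∉ ball x r → φ y = 0) ∧ (∀ y, |φ y| ≤ r ^ (-D)) ∧
  ∀ y z : X, |φ z - φ y| ≤ r ^ (-D) * (dist z y / r) ^ γ

/-- The `γ`-Hölder local grand maximal function. -/
def grandMax (m : Measure X) (D γ : ℝ) (f : X → ℝ) (x : X) : ℝ :=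
  sSup {v : ℝ | ∃ r ∈ Ioc (0:ℝ) 1, ∃ φ : X → ℝ,
    IsHolderCutoff D γ x r φ ∧ v = |∫ y, φ y * f y ∂m|}

/-- The two-sided ball bounds of an Ahlfors regular measure with a given constant. -/
def BallBounds (m : Measure X) (D A : ℝ) : Prop :=
  ∀ (x : X) (r : ℝ), 0 < r →
    ENNReal.ofReal (A⁻¹ * r ^ D) ≤ m (ball x r) ∧ m (ball x r) ≤ ENNReal.ofReal (A * r ^ D)

namespace BallBounds

variable {m : Measure X} {D A : ℝ}

theorem measure_ball_ne_top (h : BallBounds m D A) (x : X) {r : ℝ} (hr : 0 < r) :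
    m (ball x r) ≠ ∞ :=
  ((h x r hr).2.trans_lt ENNReal.ofReal_lt_top).ne

theorem measureReal_ball_le (h : BallBounds m D A) (hA : 1 ≤ A) (x : X) {r : ℝ} (hr : 0 < r) :
    m.real (ball x r) ≤ A * r ^ D :=
  ENNReal.toReal_le_of_le_ofReal (by positivity) (h x r hr).2

theorem le_measureReal_ball (h : BallBounds m D A) (x : X) {r : ℝ} (hr : 0 < r) :
    A⁻¹ * r ^ D ≤ m.real (ball x r) :=
  (ENNReal.ofReal_le_iff_le_toReal (h.measure_ball_ne_top x hr)).1 (h x r hr).1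

theorem measureReal_ball_pos (h : BallBounds m D A) (hA : 1 ≤ A) (x : X) {r : ℝ} (hr : 0 < r) :
    0 < m.real (ball x r) :=
  lt_of_lt_of_le (by positivity) (h.le_measureReal_ball x hr)

theorem measureReal_ball_le_mul (h : BallBounds m D A) (hA : 1 ≤ A) (hD : 0 < D) (x y : X)
    {R s k : ℝ} (hR : 0 < R) (hs : 0 < s) (hk : 0 < k) (hRs : R ≤ k * s) :
    m.real (ball x R) ≤ A ^ 2 * k ^ D * m.real (ball y s) := by
  calc m.real (ball x R) ≤ A * R ^ D := h.measureReal_ball_le hA x hR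
    _ ≤ A * (k * s) ^ D := by gcongr
    _ = A ^ 2 * k ^ D * (A⁻¹ * s ^ D) := by
        rw [Real.mul_rpow hk.le hs.le]
        field_simp
    _ ≤ _ := by
        gcongr
        exact h.le_measureReal_ball y hs

/-- The number of disjoint balls of comparable radii contained in a ball is bounded. -/
theorem card_le (h : BallBounds m D A) (hA : 1 ≤ A) (hD : 0 < D) (F : Finset X) (r : X → ℝ)
    (hF : (F : Set X).PairwiseDisjoint fun i => ball i (r i)) (x : X) {R k : ℝ}
    (hR : 0 < R) (hk : 0 < k) (hr : ∀ i ∈ F, 0 < r i) (hRr : ∀ i ∈ F, R ≤ k * r i)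
    (hsub : ∀ i ∈ F, ball i (r i) ⊆ ball x R) :
    (F.card : ℝ) ≤ A ^ 2 * k ^ D := by
  have hsum : ∑ i ∈ F, m.real (ball i (r i)) ≤ m.real (ball x R) := by
    rw [← measureReal_biUnion_finset hF (fun i _ => measurableSet_ball)
      (fun i hi => h.measure_ball_ne_top i (hr i hi))]
    exact measureReal_mono (iUnion₂_subset hsub) (h.measure_ball_ne_top x hR)
  have hcard : (F.card : ℝ) * m.real (ball x R) ≤
      A ^ 2 * k ^ D * ∑ i ∈ F, m.real (ball i (r i)) := by
    rw [Finset.mul_sum, ← nsmul_eq_mul]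
    exact Finset.card_nsmul_le_sum _ _ _ fun i hi =>
      h.measureReal_ball_le_mul hA hD x i hR (hr i hi) hk (hRr i hi)
  have hpos := h.measureReal_ball_pos hA x hR
  refine le_of_mul_le_mul_right (hcard.trans ?_) hpos
  gcongr

end BallBounds

theorem Set.Finite.of_forall_finset_card_le {α : Type*} {s : Set α} (n : ℝ)
    (h : ∀ F : Finset α, (F : Set α) ⊆ s → (F.card : ℝ) ≤ n) : s.Finite := by
  by_contra hs
  obtain ⟨F, hF, hc⟩ := Set.Infinite.exists_subset_card_eq hs (⌊n⌋₊ + 1)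
  have := h F hF
  rw [hc] at this
  push_cast at this
  linarith [Nat.lt_floor_add_one n]

/-- A nonnegative function attains, at some point of a set, at most a multiple of its average
over any larger set of comparable measure. -/
theorem exists_mem_le_mul_setAvg {α : Type*} [MeasurableSpace α] {m : Measure α} {B : Set α}
    (hB : m.real B ≠ 0) {g : α → ℝ}
    (hg : ∀ x, 0 ≤ g x) (hgB : IntegrableOn g B m) :
    ∃ p ∈ B, ∀ (B' : Set α) (C : ℝ), B ⊆ B' → IntegrableOn g B' m → 0 < m.real B' →
      m.real B' ≤ C * m.real B → g p ≤ C * setAvg m B' g := by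
  have h0 : m B ≠ 0 := fun h => hB (by simp [measureReal_def, h])
  have htop : m B ≠ ∞ := fun h => hB (by simp [measureReal_def, h])
  obtain ⟨p, hp, hle⟩ := exists_le_setAverage h0 htop hgB
  refine ⟨p, hp, fun B' C hBB' hgB' hpos hC => hle.trans ?_⟩
  have hBpos : 0 < m.real B := lt_of_le_of_ne measureReal_nonneg (Ne.symm hB)
  have hint : ∫ x in B, g x ∂m ≤ ∫ x in B', g x ∂m :=
    setIntegral_mono_set hgB' (Filter.Eventually.of_forall hg) hBB'.eventuallyLE
  have hnn : 0 ≤ ∫ x in B, g x ∂m := integral_nonneg hg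
  have hinv : (m.real B)⁻¹ ≤ C * (m.real B')⁻¹ := by
    rw [← div_eq_mul_inv, le_div_iff₀ hpos, inv_mul_le_iff₀ hBpos]
    linarith
  rw [setAverage_eq, smul_eq_mul, setAvg, ← mul_assoc]
  exact mul_le_mul hinv hint hnn ((inv_pos.2 hBpos).le.trans hinv)

/-- Covering lemma with controlled overlap and average bounds at the chosen points. -/
theorem statement4 (m : Measure X) (D : ℝ) (hD : 0 < D) (hX : AhlforsRegular m D)
    (a : ℝ) (ha : a ∈ Ioc (0:ℝ) 1) :
    ∃ C : ℝ, 0 < C ∧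
      ∀ (o : X) (t : ℝ), t ∈ Ioc (0:ℝ) (1/2) →
        ∀ g : X → ℝ, Measurable g → (∀ x, 0 ≤ g x) →
          (∀ (x : X) (r : ℝ), IntegrableOn g (ball x r) m) →
          ∃ (J : Finset ℕ) (xp : ℕ → X),
            (∀ j ∈ J, t * (1 + dist o (xp j)) ≤ 1) ∧
            (∀ x : X,
              (∑ j ∈ J, (ball (xp j) (t * (1 + dist o (xp j)))).indicator
                (fun _ => (1:ℝ)) x) ≤ C) ∧
            (∀ x : X, t * (1 + dist o x) ≤ 1/2 →
              (1:ℝ) ≤ ∑ j ∈ J, (ball (xp j) (a * t * (1 + dist o (xp j)))).indicator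
                (fun _ => (1:ℝ)) x) ∧
            ∀ j ∈ J, g (xp j) ≤ C * setAvg m (ball (xp j) (t * (1 + dist o (xp j)))) g := by
  obtain ⟨A, hA, h : BallBounds m D A⟩ := hX
  obtain ⟨ha0, ha1⟩ := ha
  have hk : 0 < 80 / a := by positivity
  refine ⟨A ^ 2 * (80 / a) ^ D, by positivity, ?_⟩
  rintro o t ⟨ht0, ht⟩ g - hg hgint
  set ρ : X → ℝ := fun x => t * (1 + dist o x) with hρ
  have hρt : ∀ x, t ≤ ρ x := fun x => by
    have := mul_nonneg ht0.le (dist_nonneg (x := o) (y := x))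
    simp only [hρ]; linarith
  have hρpos : ∀ x, 0 < ρ x := fun x => ht0.trans_le (hρt x)
  have hρlip : ∀ x y, ρ x ≤ ρ y + dist x y / 2 := fun x y => by
    have h1 : dist o x ≤ dist o y + dist x y := by
      rw [dist_comm x y]; exact dist_triangle _ _ _
    have h2 := mul_le_mul_of_nonneg_left h1 ht0.le
    have h3 := mul_le_mul_of_nonneg_right ht (dist_nonneg (x := x) (y := y))
    simp only [hρ]; linarith
  -- a maximal disjoint family of small balls
  set r : X → ℝ := fun y => a / 10 * ρ y with hr
  have hrpos : ∀ y, 0 < r y := fun y => by have := hρpos y; simp only [hr]; positivity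
  have hr10 : ∀ y, r y ≤ ρ y / 10 := fun y => by
    have := mul_le_mul_of_nonneg_right ha1 (hρpos y).le
    simp only [hr]; linarith
  obtain ⟨u, hu, hdisj, hcov⟩ := Vitali.exists_disjoint_subfamily_covering_enlargement
    (fun y => ball y (r y)) {y : X | ρ y ≤ 1 / 2} r 2 one_lt_two (fun y _ => (hrpos y).le) 1
    (fun y hy => by have := hr10 y; change ρ y ≤ 1 / 2 at hy; linarith)
    (fun y _ => ⟨y, mem_ball_self (hrpos y)⟩)
  have hfin : u.Finite := by
    have hR : 0 < 1 / t := by positivity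
    refine Set.Finite.of_forall_finset_card_le
      (A ^ 2 * (1 / t / (a / 10 * t)) ^ D) fun F hF => ?_
    refine h.card_le hA hD F r (hdisj.subset hF) o hR (by positivity) (fun i _ => hrpos i)
      (fun i _ => ?_) (fun i hi z hz => ?_)
    · have : a / 10 * t ≤ r i := mul_le_mul_of_nonneg_left (hρt i) (by positivity)
      calc 1 / t = 1 / t / (a / 10 * t) * (a / 10 * t) := by field_simp
        _ ≤ _ := by gcongr
    · have h1 : ρ i ≤ 1 / 2 := hu (hF hi)
      have h2 := hr10 i
      have h3 := hρlip z i
      rw [mem_ball] at hz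
      have h4 : ρ z < 1 := by linarith
      rw [mem_ball, dist_comm, lt_div_iff₀ ht0]
      simp only [hρ] at h4
      linarith
  have hpt : ∀ y : X, ∃ p ∈ ball y (r y), ∀ (B' : Set X) (C : ℝ), ball y (r y) ⊆ B' →
      IntegrableOn g B' m → 0 < m.real B' → m.real B' ≤ C * m.real (ball y (r y)) →
      g p ≤ C * setAvg m B' g := fun y =>
    exists_mem_le_mul_setAvg (h.measureReal_ball_pos hA y (hrpos y)).ne' hg (hgint y _)
  choose p hp hpavg using hpt
  have hdp : ∀ y, dist (p y) y < r y := fun y => mem_ball.1 (hp y)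
  have hρp : ∀ y, ρ (p y) ≤ 21 / 20 * ρ y := fun y => by
    linarith [hρlip (p y) y, hdp y, hr10 y]
  have hρp' : ∀ y, 19 / 20 * ρ y ≤ ρ (p y) := fun y => by
    have := hρlip y (p y)
    rw [dist_comm] at this
    linarith [hdp y, hr10 y]
  obtain ⟨f, hf⟩ := Set.countable_iff_exists_injOn.1 hfin.countable
  set F := hfin.toFinset with hF
  have hFu : ∀ {y}, y ∈ F ↔ y ∈ u := by simp [hF]
  have hfF : Set.InjOn f F := by simpa [hF] using hf
  have : Nonempty X := ⟨o⟩
  have hinv : ∀ y ∈ F, Function.invFunOn f u (f y) = y := fun y hy =>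
    hf.leftInvOn_invFunOn (hFu.1 hy)
  have hsum : ∀ φ : X → ℝ, ∑ j ∈ F.image f, φ (p (Function.invFunOn f u j)) =
      ∑ y ∈ F, φ (p y) := fun φ => by
    rw [Finset.sum_image hfF]
    exact Finset.sum_congr rfl fun y hy => by rw [hinv y hy]
  refine ⟨F.image f, fun j => p (Function.invFunOn f u j), ?_, fun x => ?_, fun x hx => ?_, ?_⟩
  · rw [Finset.forall_mem_image]
    intro y hy
    simp only [hinv y hy]
    have h1 : ρ y ≤ 1 / 2 := hu (hFu.1 hy)
    change ρ (p y) ≤ 1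
    linarith [hρp y]
  · rw [hsum fun q => (ball q (ρ q)).indicator (fun _ => (1 : ℝ)) x]
    classical
    have hcard : ∑ y ∈ F, (ball (p y) (ρ (p y))).indicator (fun _ => (1 : ℝ)) x =
        ((F.filter fun y => x ∈ ball (p y) (ρ (p y))).card : ℝ) := by
      simp [Set.indicator_apply, Finset.sum_boole]
    rw [hcard]
    have key : ∀ y ∈ F.filter (fun y => x ∈ ball (p y) (ρ (p y))),
        dist x (p y) < ρ (p y) := fun y hy => mem_ball.1 (Finset.mem_filter.1 hy).2
    refine h.card_le hA hD _ r (hdisj.subset fun y hy => ?_) x (R := 4 * ρ x)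
      (by linarith [hρpos x]) hk (fun i _ => hrpos i) (fun y hy => ?_) (fun y hy z hz => ?_)
    · exact hFu.1 (Finset.mem_filter.1 hy).1
    · have h1 := hρlip x (p y)
      have h2 : 80 / a * r y = 8 * ρ y := by simp only [hr]; field_simp; ring
      linarith [key y hy, hρp y, hρpos y]
    · have h1 := hρlip (p y) x
      rw [dist_comm] at h1
      rw [mem_ball] at hz ⊢
      have h2 := dist_triangle4 z y (p y) x
      rw [dist_comm y, dist_comm (p y) x] at h2
      linarith [key y hy, hρp' y, hr10 y, hdp y, hρpos x]
  · obtain ⟨y, hy, ⟨z, hzx, hzy⟩, -⟩ := hcov x hx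
    simp only [mul_assoc a t]
    rw [hsum fun q => (ball q (a * ρ q)).indicator (fun _ => (1 : ℝ)) x]
    have hmem : x ∈ ball (p y) (a * ρ (p y)) := by
      rw [mem_ball] at hzx hzy ⊢
      have h1 := dist_triangle_left x y z
      have h2 := dist_triangle_right x (p y) y
      have h3 : ρ x ≤ 6 / 5 * ρ y := by
        linarith [hρlip x y, hr10 x, hr10 y, hρpos y]
      have h4 := mul_le_mul_of_nonneg_left h3 ha0.le
      have h5 := mul_le_mul_of_nonneg_left (hρp' y) ha0.le
      have h6 := mul_pos ha0 (hρpos y)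
      have h7 := hdp y
      simp only [hr] at hzx hzy h7
      linarith
    calc (1 : ℝ) = (ball (p y) (a * ρ (p y))).indicator (fun _ => (1 : ℝ)) x := by
          rw [Set.indicator_of_mem hmem]
      _ ≤ _ := Finset.single_le_sum
          (f := fun y => (ball (p y) (a * ρ (p y))).indicator (fun _ => (1 : ℝ)) x)
          (fun i _ => Set.indicator_nonneg (fun _ _ => zero_le_one) x) (hFu.2 hy)
  · rw [Finset.forall_mem_image]
    intro y hy
    simp only [hinv y hy]
    refine hpavg y (ball (p y) (ρ (p y))) _ (fun z hz => ?_) (hgint _ _)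
      (h.measureReal_ball_pos hA _ (hρpos _))
      (h.measureReal_ball_le_mul hA hD _ _ (hρpos _) (hrpos y) hk ?_)
    · rw [mem_ball] at hz ⊢
      have h1 := dist_triangle_right z (p y) y
      linarith [hdp y, hr10 y, hρp' y, hρpos y]
    · have h2 : 80 / a * r y = 8 * ρ y := by simp only [hr]; field_simp; ring
      linarith [hρp y, hρpos y]

end
end

section
/- Let (X,d,m) be a uniformly locally n-Ahlfors metric measure space and let K be a λ-local approximation of the identity of exponent γ ∈ (0,1] on X, for some λ > 0. Then there exists a constant C > 0 such that ‖K_* a‖_{L¹(X)} ≤ C for every 2-atom a at scale λ on X (standard or global). -/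
open MeasureTheory Metric Set ENNReal

noncomputable section

variable {X : Type*} [MetricSpace X] [MeasurableSpace X] [BorelSpace X]

/-- `(X,d,m)` is uniformly locally `n`-Ahlfors: for every scale `s > 0` there is a
constant `Ds > 0` with `Ds⁻¹ r^n ≤ m(B(x,r)) ≤ Ds r^n` for all `x` and `0 < r ≤ s`. -/
def UnifLocAhlfors (m : Measure X) (n : ℝ) : Prop :=
  ∀ s : ℝ, 0 < s → ∃ Ds : ℝ, 0 < Ds ∧ ∀ (x : X) (r : ℝ), 0 < r → r ≤ s →
    ENNReal.ofReal (Ds⁻¹ * r ^ n) ≤ m (ball x r) ∧ m (ball x r) ≤ ENNReal.ofReal (Ds * r ^ n)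

/-- `K` is a `lam`-local approximation of the identity of exponent `γ`
(with dimensional parameter `n`). -/
def IsLAI (n γ lam : ℝ) (K : ℝ → X → X → ℝ) : Prop :=
  Measurable (fun q : ℝ × X × X => K q.1 q.2.1 q.2.2) ∧
  (∀ t ∈ Ioc (0:ℝ) 1, ∀ x y : X, 0 ≤ K t x y) ∧
  ∃ C₁ C₂ C₃ : ℝ, 0 < C₁ ∧ 0 < C₂ ∧ 0 < C₃ ∧
    ∀ t ∈ Ioc (0:ℝ) 1, ∀ x y z : X, 4 * dist y z ≤ t + dist x y →
      (lam < dist x y → K t x y = 0) ∧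
      K t x y ≤ C₁ * t ^ (-n) * (1 + dist x y / t) ^ (-n - γ) ∧
      C₂ * t ^ (-n) ≤ K t x x ∧
      |K t x y - K t x z| ≤
        C₃ * t ^ (-n) * (dist y z / t) ^ γ * (1 + dist x y / t) ^ (-n - 2 * γ)

/-- The centred local Hardy–Littlewood maximal function at scale `R`. -/
def locHLMax (m : Measure X) (R : ℝ) (f : X → ℝ) (x : X) : ℝ :=
  ⨆ r : Ioc (0:ℝ) R, setAvg m (ball x r.1) fun y => |f y|

/-- `a` is a `p`-atom at scale `s`: supported in a ball `B` with `‖a‖_p ≤ m(B)^{-1/p'}`,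
and either `B` has radius at most `s` and `a` has vanishing integral (standard atom),
or `B` has radius exactly `s` (global atom). -/
def IsAtomAtScale (m : Measure X) (p : ℝ≥0∞) (s : ℝ) (a : X → ℝ) : Prop :=
  Integrable a m ∧ ∃ (x₀ : X) (r : ℝ), 0 < r ∧
    (∀ y, y ∉ ball x₀ r → a y = 0) ∧
    eLpNorm a p m ≤ m (ball x₀ r) ^ (p⁻¹.toReal - 1) ∧
    ((r ≤ s ∧ (∫ y, a y ∂m) = 0) ∨ r = s)

set_option linter.unusedSectionVars false

/-- The balls `ball c ρ`, `0 < ρ ≤ R`, coded by `(c, ρ)`, on which the mean of `f`,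
normalised by `ρ ^ n`, exceeds `T`. -/
def heavyBalls (m : Measure X) (n R T : ℝ) (f : X → ℝ≥0∞) : Set (X × ℝ) :=
  {p | 0 < p.2 ∧ p.2 ≤ R ∧ ENNReal.ofReal (T * p.2 ^ n) < ∫⁻ y in ball p.1 p.2, f y ∂m}

/-- Weak type `(1,1)` bound for the uncentred local maximal function. -/
theorem measure_biUnion_heavyBalls_le (m : Measure X) {n D R T : ℝ} (hD0 : 0 ≤ D) (hT : 0 < T)
    (hD : ∀ (x : X) (r : ℝ), 0 < r → r ≤ 6 * R → m (ball x r) ≤ ENNReal.ofReal (D * r ^ n))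
    {f : X → ℝ≥0∞} (hf : ∫⁻ y, f y ∂m ≠ ∞) :
    m (⋃ p ∈ heavyBalls m n R T f, ball p.1 p.2) ≤
      ENNReal.ofReal (D * 6 ^ n / T) * ∫⁻ y, f y ∂m := by
  obtain ⟨u, hut, hdisj, hcov⟩ :=
    Vitali.exists_disjoint_subfamily_covering_enlargement_closedBall (heavyBalls m n R T f)
      Prod.fst Prod.snd R (fun p hp => hp.2.1) 5 (by norm_num)
  have hdisj' : u.PairwiseDisjoint fun p => ball p.1 p.2 :=
    hdisj.mono fun p => ball_subset_closedBall
  have hucount : u.Countable := by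
    have h := Measure.countable_meas_pos_of_disjoint_of_meas_iUnion_ne_top (m.withDensity f)
      (As := fun p : u => ball p.1.1 p.1.2) (fun p => measurableSet_ball)
      (fun p q hpq => hdisj' p.2 q.2 (fun h => hpq (Subtype.ext h)))
      (ne_top_of_le_ne_top hf (by
        refine (measure_mono (subset_univ _)).trans_eq ?_
        rw [withDensity_apply _ MeasurableSet.univ, setLIntegral_univ]))
    have huniv : {i : u | 0 < m.withDensity f (ball i.1.1 i.1.2)} = univ := by
      ext p
      simp only [mem_ofPred_eq, mem_univ, iff_true]
      rw [withDensity_apply _ measurableSet_ball]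
      exact lt_of_le_of_lt zero_le (hut p.2).2.2
    rw [huniv, countable_univ_iff] at h
    exact h.to_set
  have hsub : (⋃ p ∈ heavyBalls m n R T f, ball p.1 p.2) ⊆ ⋃ p ∈ u, ball p.1 (6 * p.2) := by
    intro y hy
    simp only [mem_iUnion, exists_prop] at hy ⊢
    obtain ⟨p, hp, hyp⟩ := hy
    obtain ⟨q, hq, hpq⟩ := hcov p hp
    refine ⟨q, hq, closedBall_subset_ball ?_ (hpq (ball_subset_closedBall hyp))⟩
    linarith [(hut hq).1]
  calc m (⋃ p ∈ heavyBalls m n R T f, ball p.1 p.2)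
      ≤ ∑' p : u, m (ball p.1.1 (6 * p.1.2)) :=
        (measure_mono hsub).trans (measure_biUnion_le m hucount _)
    _ ≤ ∑' p : u, ENNReal.ofReal (D * 6 ^ n / T) * ∫⁻ y in ball p.1.1 p.1.2, f y ∂m := by
        refine ENNReal.tsum_le_tsum fun p => ?_
        obtain ⟨hp0, hpR, hp⟩ := hut p.2
        calc m (ball p.1.1 (6 * p.1.2)) ≤ ENNReal.ofReal (D * (6 * p.1.2) ^ n) :=
              hD _ _ (by positivity) (by linarith)
          _ = ENNReal.ofReal (D * 6 ^ n / T) * ENNReal.ofReal (T * p.1.2 ^ n) := by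
              rw [← ENNReal.ofReal_mul (by positivity), Real.mul_rpow (by norm_num) hp0.le]
              congr 1
              field_simp
          _ ≤ _ := by gcongr
    _ = ENNReal.ofReal (D * 6 ^ n / T) * ∫⁻ y in ⋃ p ∈ u, ball p.1 p.2, f y ∂m := by
        rw [ENNReal.tsum_mul_left, lintegral_biUnion hucount (fun _ _ => measurableSet_ball) hdisj']
    _ ≤ _ := by
        gcongr
        exact Measure.restrict_le_self

/-- The constant `2 ^ (n + γ) * ∑ k, 2 ^ (-k * γ)`. -/
def decayConst (n γ : ℝ) : ℝ := 2 ^ (n + γ) * (1 - 2 ^ (-γ))⁻¹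

theorem decayConst_pos (n : ℝ) {γ : ℝ} (hγ : 0 < γ) : 0 < decayConst n γ := by
  have : (2:ℝ) ^ (-γ) < 1 := Real.rpow_lt_one_of_one_lt_of_neg one_lt_two (by linarith)
  have : 0 < 1 - (2:ℝ) ^ (-γ) := by linarith
  unfold decayConst
  positivity

/-- A kernel of size `t ^ (-n) * (1 + dist x y / t) ^ (-n - γ)` is controlled by averages over
dyadic balls centred at `x`. -/
theorem setLIntegral_closedBall_decay_mul_le (m : Measure X) {n γ R t : ℝ} (hn : 0 < n)
    (hγ : 0 < γ) (ht : 0 < t) (htR : t ≤ R) (x : X) {g : X → ℝ≥0∞} (hg : AEMeasurable g m)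
    {M : ℝ≥0∞} (hM : ∀ ρ, 0 < ρ → ρ ≤ R → ∫⁻ y in ball x ρ, g y ∂m ≤ M * ENNReal.ofReal (ρ ^ n)) :
    ∫⁻ y in closedBall x (R / 2),
        ENNReal.ofReal (t ^ (-n) * (1 + dist x y / t) ^ (-n - γ)) * g y ∂m ≤
      M * ENNReal.ofReal (decayConst n γ) := by
  have hq0 : (0:ℝ) < 2 ^ (-γ) := by positivity
  have hq1 : (2:ℝ) ^ (-γ) < 1 := Real.rpow_lt_one_of_one_lt_of_neg one_lt_two (by linarith)
  set c : ℕ → ℝ := fun k => 2 ^ (n + γ) * (2 ^ k * t) ^ (-n) * ((2:ℝ) ^ (-γ)) ^ k with hc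
  set F : ℕ → X → ℝ≥0∞ := fun k y =>
    if 2 ^ k * t ≤ R then (ball x (2 ^ k * t)).indicator (fun y => ENNReal.ofReal (c k) * g y) y
    else 0 with hF
  have hpt : ∀ y ∈ closedBall x (R / 2),
      ENNReal.ofReal (t ^ (-n) * (1 + dist x y / t) ^ (-n - γ)) * g y ≤ ∑' k, F k y := by
    intro y hy
    rw [mem_closedBall, dist_comm] at hy
    have hex : ∃ k : ℕ, dist x y < 2 ^ k * t := by
      obtain ⟨k, hk⟩ := pow_unbounded_of_one_lt (dist x y / t) one_lt_two
      exact ⟨k, (div_lt_iff₀ ht).1 hk⟩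
    classical
    obtain ⟨k, hk, hk2, hkR⟩ : ∃ k : ℕ, dist x y < 2 ^ k * t ∧ (2:ℝ) ^ k / 2 ≤ 1 + dist x y / t ∧
        2 ^ k * t ≤ R := by
      refine ⟨Nat.find hex, Nat.find_spec hex, ?_⟩
      rcases hj : Nat.find hex with _ | j
      · have : 0 ≤ dist x y / t := by positivity
        constructor
        · norm_num; linarith
        · simpa using htR
      · have hmin := Nat.find_min hex (m := j) (by omega)
        rw [not_lt] at hmin
        have := (le_div_iff₀ ht).2 hmin
        constructor
        · rw [pow_succ]; linarith
        · rw [pow_succ]; linarith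
    refine le_trans ?_ (ENNReal.le_tsum k)
    simp only [hF]
    rw [if_pos hkR, indicator_of_mem (by rwa [mem_ball, dist_comm])]
    gcongr
    calc t ^ (-n) * (1 + dist x y / t) ^ (-n - γ) ≤ t ^ (-n) * (2 ^ k / 2) ^ (-n - γ) := by
          gcongr ?_ * ?_
          exact Real.rpow_le_rpow_of_nonpos (by positivity) hk2 (by linarith)
      _ = c k := by
          simp only [hc]
          rw [Real.mul_rpow (by positivity) ht.le, ← Real.rpow_mul_natCast (by norm_num),
            mul_comm (-γ), Real.rpow_natCast_mul (by norm_num), Real.div_rpow (by positivity) (by norm_num),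
            sub_eq_add_neg (-n), Real.rpow_add (by positivity), show -n + -γ = -(n + γ) by ring,
            Real.rpow_neg (by norm_num) (n + γ)]
          field_simp
  have hFm : ∀ k, AEMeasurable (F k) m := by
    intro k
    by_cases h : 2 ^ k * t ≤ R
    · simp only [hF, if_pos h]
      exact (hg.const_mul _).indicator measurableSet_ball
    · simp only [hF, if_neg h]
      exact aemeasurable_const
  calc _ ≤ ∫⁻ y in closedBall x (R / 2), ∑' k, F k y ∂m :=
        setLIntegral_mono' measurableSet_closedBall hpt
    _ ≤ ∫⁻ y, ∑' k, F k y ∂m := setLIntegral_le_lintegral _ _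
    _ = ∑' k, ∫⁻ y, F k y ∂m := lintegral_tsum hFm
    _ ≤ ∑' k : ℕ, M * ENNReal.ofReal (2 ^ (n + γ) * ((2:ℝ) ^ (-γ)) ^ k) := by
        refine ENNReal.tsum_le_tsum fun k => ?_
        have h2k : 0 < 2 ^ k * t := by positivity
        by_cases h : 2 ^ k * t ≤ R
        · simp only [hF, if_pos h]
          rw [lintegral_indicator measurableSet_ball, lintegral_const_mul' _ _ ENNReal.ofReal_ne_top]
          calc _ ≤ ENNReal.ofReal (c k) * (M * ENNReal.ofReal ((2 ^ k * t) ^ n)) := by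
                gcongr
                exact hM _ h2k h
            _ = _ := by
                rw [mul_left_comm, ← ENNReal.ofReal_mul (by positivity)]
                congr 2
                simp only [hc]
                rw [Real.rpow_neg h2k.le]
                field_simp
        · simp [hF, if_neg h]
    _ = _ := by
        rw [ENNReal.tsum_mul_left, ← ENNReal.ofReal_tsum_of_nonneg (fun k => by positivity)
          ((summable_geometric_of_lt_one hq0.le hq1).mul_left _), tsum_mul_left,
          tsum_geometric_of_lt_one hq0.le hq1, decayConst]

theorem enorm_maxOp_le {m : Measure X} {K : ℝ → X → X → ℝ} {a : X → ℝ} {x : X} {M : ℝ≥0∞}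
    (h : ∀ t ∈ Ioc (0:ℝ) 1, ‖∫ y, K t x y * a y ∂m‖ₑ ≤ M) : ‖maxOp m K a x‖ₑ ≤ M := by
  rcases eq_or_ne M ∞ with rfl | hM
  · exact le_top
  have h0 : 0 ≤ maxOp m K a x := Real.iSup_nonneg fun _ => abs_nonneg _
  rw [Real.enorm_of_nonneg h0]
  refine ENNReal.ofReal_le_of_le_toReal (Real.iSup_le (fun t => ?_) ENNReal.toReal_nonneg)
  have := ENNReal.toReal_mono hM (h t.1 t.2)
  rwa [toReal_enorm, Real.norm_eq_abs] at this

/-- Young's inequality `b ≤ T + b ^ 2 / T`. -/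
theorem ennreal_le_add_inv_mul_sq {T : ℝ} (hT : 0 < T) (b : ℝ≥0∞) :
    b ≤ ENNReal.ofReal T + ENNReal.ofReal T⁻¹ * b ^ 2 := by
  rcases le_total b (ENNReal.ofReal T) with h | h
  · exact h.trans le_self_add
  · calc b = ENNReal.ofReal T⁻¹ * (ENNReal.ofReal T * b) := by
          rw [← mul_assoc, ← ENNReal.ofReal_mul (by positivity), inv_mul_cancel₀ hT.ne']
          simp
      _ ≤ ENNReal.ofReal T⁻¹ * (b * b) := by gcongr
      _ ≤ _ := by rw [sq]; exact le_add_self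

/-- An integral estimate for `F` from a weak type `(2,2)` estimate for a majorant of `F`. -/
theorem setLIntegral_le_of_heavyBalls (m : Measure X) {n D R A c : ℝ} (hD0 : 0 ≤ D) (hA : 0 < A)
    (hc : 0 < c)
    (hD : ∀ (x : X) (r : ℝ), 0 < r → r ≤ 6 * R → m (ball x r) ≤ ENNReal.ofReal (D * r ^ n))
    {f F : X → ℝ≥0∞} (hf : ∫⁻ y, f y ∂m ≠ ∞)
    (hF : ∀ x T, 0 < T → (x ∉ ⋃ p ∈ heavyBalls m n R (T ^ 2) f, ball p.1 p.2) →
      F x ≤ ENNReal.ofReal (c * T)) (S : Set X) :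
    ∫⁻ x in S, F x ∂m ≤
      ENNReal.ofReal (c * A) * m S + ENNReal.ofReal (2 * c * D * 6 ^ n / A) * ∫⁻ y, f y ∂m := by
  set U : ℕ → Set X := fun k => ⋃ p ∈ heavyBalls m n R ((2 ^ k * A) ^ 2) f, ball p.1 p.2 with hU
  have hUm : ∀ k, MeasurableSet (U k) := fun k =>
    (isOpen_biUnion fun _ _ => isOpen_ball).measurableSet
  have hpt : ∀ x, F x ≤ ENNReal.ofReal (c * A) +
      ∑' k, (U k).indicator (fun _ => ENNReal.ofReal (c * (2 ^ k * A))) x := by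
    intro x
    by_cases hx : ∃ k, x ∉ U k
    · classical
      refine (hF x (2 ^ Nat.find hx * A) (by positivity) (Nat.find_spec hx)).trans ?_
      have key : ∀ j : ℕ, (∀ k < j, x ∈ U k) → ENNReal.ofReal (c * (2 ^ j * A)) ≤
          ENNReal.ofReal (c * A) + ∑ k ∈ Finset.range j,
            (U k).indicator (fun _ => ENNReal.ofReal (c * (2 ^ k * A))) x := by
        intro j
        induction j with
        | zero => simp
        | succ j ih =>
          intro h
          rw [Finset.sum_range_succ, indicator_of_mem (h j (by omega)), ← add_assoc,
            show c * (2 ^ (j + 1) * A) = c * (2 ^ j * A) + c * (2 ^ j * A) by ring,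
            ENNReal.ofReal_add (by positivity) (by positivity)]
          gcongr
          exact ih fun k hk => h k (by omega)
      refine (key _ fun k hk => not_not.1 (Nat.find_min hx hk)).trans ?_
      gcongr
      exact ENNReal.sum_le_tsum _
    · push Not at hx
      have : ∑' k, (U k).indicator (fun _ => ENNReal.ofReal (c * (2 ^ k * A))) x = ∞ := by
        rw [eq_top_iff, ← ENNReal.tsum_const_eq_top_of_ne_zero (α := ℕ)
          (c := ENNReal.ofReal (c * A)) (by simpa using by positivity)]
        refine ENNReal.tsum_le_tsum fun k => ?_
        rw [indicator_of_mem (hx k)]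
        gcongr
        exact le_mul_of_one_le_left hA.le (one_le_pow₀ one_le_two)
      simp [this]
  calc ∫⁻ x in S, F x ∂m
      ≤ ∫⁻ x in S, (ENNReal.ofReal (c * A) +
        ∑' k, (U k).indicator (fun _ => ENNReal.ofReal (c * (2 ^ k * A))) x) ∂m :=
        lintegral_mono hpt
    _ = ENNReal.ofReal (c * A) * m S +
        ∑' k, ENNReal.ofReal (c * (2 ^ k * A)) * m.restrict S (U k) := by
        rw [lintegral_add_left measurable_const, setLIntegral_const,
          lintegral_tsum fun k => (measurable_const.indicator (hUm k)).aemeasurable]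
        simp_rw [lintegral_indicator_const (hUm _)]
    _ ≤ ENNReal.ofReal (c * A) * m S +
        ∑' k : ℕ, ENNReal.ofReal (c * D * 6 ^ n / A * (1 / 2) ^ k) * ∫⁻ y, f y ∂m := by
        refine add_le_add le_rfl (ENNReal.tsum_le_tsum fun k => ?_)
        calc _ ≤ ENNReal.ofReal (c * (2 ^ k * A)) *
              (ENNReal.ofReal (D * 6 ^ n / (2 ^ k * A) ^ 2) * ∫⁻ y, f y ∂m) := by
              gcongr
              exact (Measure.restrict_apply_le _ _).trans
                (measure_biUnion_heavyBalls_le m hD0 (by positivity) hD hf)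
          _ = _ := by
              rw [← mul_assoc, ← ENNReal.ofReal_mul (by positivity)]
              congr 2
              rw [one_div, inv_pow]
              field_simp
    _ = _ := by
        rw [ENNReal.tsum_mul_right, ← ENNReal.ofReal_tsum_of_nonneg (fun k => by positivity)
          (summable_geometric_two.mul_left _), tsum_mul_left, tsum_geometric_two]
        ring_nf

/-- Pointwise domination of `K_*` by the local Hardy–Littlewood maximal function. -/
theorem enorm_maxOp_le_of_averages (m : Measure X) {n γ lam R C₁ : ℝ} (hn : 0 < n) (hγ : 0 < γ)
    (hC₁ : 0 ≤ C₁) (hR : 1 ≤ R) (hlamR : 2 * lam ≤ R) {K : ℝ → X → X → ℝ}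
    (hsupp : ∀ t ∈ Ioc (0:ℝ) 1, ∀ x y, lam < dist x y → K t x y = 0)
    (hsize : ∀ t ∈ Ioc (0:ℝ) 1, ∀ x y,
      |K t x y| ≤ C₁ * (t ^ (-n) * (1 + dist x y / t) ^ (-n - γ)))
    {a : X → ℝ} (ha : AEMeasurable a m) {x : X} {M : ℝ≥0∞}
    (hM : ∀ ρ, 0 < ρ → ρ ≤ R → ∫⁻ y in ball x ρ, ‖a y‖ₑ ∂m ≤ M * ENNReal.ofReal (ρ ^ n)) :
    ‖maxOp m K a x‖ₑ ≤ ENNReal.ofReal C₁ * (M * ENNReal.ofReal (decayConst n γ)) := by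
  refine enorm_maxOp_le fun t ht => (enorm_integral_le_lintegral_enorm _).trans ?_
  calc ∫⁻ y, ‖K t x y * a y‖ₑ ∂m
      ≤ ∫⁻ y in closedBall x (R / 2), ENNReal.ofReal C₁ *
        (ENNReal.ofReal (t ^ (-n) * (1 + dist x y / t) ^ (-n - γ)) * ‖a y‖ₑ) ∂m := by
        rw [← lintegral_indicator measurableSet_closedBall]
        refine lintegral_mono fun y => ?_
        by_cases hy : y ∈ closedBall x (R / 2)
        · rw [indicator_of_mem hy, enorm_mul, ← mul_assoc, ← ENNReal.ofReal_mul hC₁]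
          gcongr
          rw [← ofReal_norm, Real.norm_eq_abs]
          exact ENNReal.ofReal_le_ofReal (hsize t ht x y)
        · rw [mem_closedBall, not_le, dist_comm] at hy
          simp [hsupp t ht x y (by linarith)]
    _ ≤ _ := by
        rw [lintegral_const_mul' _ _ ENNReal.ofReal_ne_top]
        gcongr
        exact setLIntegral_closedBall_decay_mul_le m hn hγ ht.1 (ht.2.trans hR) x ha.enorm hM

theorem setLIntegral_le_add_setLIntegral_sq (m : Measure X) {T : ℝ} (hT : 0 < T) (S : Set X)
    (g : X → ℝ≥0∞) :
    ∫⁻ y in S, g y ∂m ≤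
      ENNReal.ofReal T * m S + ENNReal.ofReal T⁻¹ * ∫⁻ y in S, g y ^ 2 ∂m := by
  refine (lintegral_mono fun y => ennreal_le_add_inv_mul_sq hT (g y)).trans_eq ?_
  rw [lintegral_add_left measurable_const, setLIntegral_const,
    lintegral_const_mul' _ _ ENNReal.ofReal_ne_top]

/-- Integral of `K_* a` over a set, for `a ∈ L²`. -/
theorem setLIntegral_enorm_maxOp_le (m : Measure X) {n γ lam R C₁ D A : ℝ} (hn : 0 < n)
    (hγ : 0 < γ) (hC₁ : 0 < C₁) (hR : 1 ≤ R) (hlamR : 2 * lam ≤ R) (hD0 : 0 < D) (hA : 0 < A)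
    (hD : ∀ (x : X) (r : ℝ), 0 < r → r ≤ 6 * R → m (ball x r) ≤ ENNReal.ofReal (D * r ^ n))
    {K : ℝ → X → X → ℝ} (hsupp : ∀ t ∈ Ioc (0:ℝ) 1, ∀ x y, lam < dist x y → K t x y = 0)
    (hsize : ∀ t ∈ Ioc (0:ℝ) 1, ∀ x y,
      |K t x y| ≤ C₁ * (t ^ (-n) * (1 + dist x y / t) ^ (-n - γ)))
    {a : X → ℝ} (ha : AEMeasurable a m) (ha2 : ∫⁻ y, ‖a y‖ₑ ^ 2 ∂m ≠ ∞) (S : Set X) :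
    ∫⁻ x in S, ‖maxOp m K a x‖ₑ ∂m ≤
      ENNReal.ofReal (C₁ * ((D + 1) * decayConst n γ) * A) * m S +
      ENNReal.ofReal (2 * (C₁ * ((D + 1) * decayConst n γ)) * D * 6 ^ n / A) *
        ∫⁻ y, ‖a y‖ₑ ^ 2 ∂m := by
  have hS := decayConst_pos n hγ
  refine setLIntegral_le_of_heavyBalls m hD0.le hA (by positivity) hD ha2 (fun x T hT hx => ?_) S
  refine (enorm_maxOp_le_of_averages m hn hγ hC₁.le hR hlamR hsupp hsize ha
    (M := ENNReal.ofReal ((D + 1) * T)) fun ρ hρ hρR => ?_).trans_eq ?_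
  · have h2 : ∫⁻ y in ball x ρ, ‖a y‖ₑ ^ 2 ∂m ≤ ENNReal.ofReal (T ^ 2 * ρ ^ n) := by
      by_contra! h
      exact hx (mem_biUnion (x := (x, ρ)) ⟨hρ, hρR, h⟩ (mem_ball_self hρ))
    calc _ ≤ _ := setLIntegral_le_add_setLIntegral_sq m hT _ _
      _ ≤ ENNReal.ofReal T * ENNReal.ofReal (D * ρ ^ n) +
          ENNReal.ofReal T⁻¹ * ENNReal.ofReal (T ^ 2 * ρ ^ n) := by
        gcongr
        exact hD x ρ hρ (by linarith)
      _ = _ := by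
        rw [← ENNReal.ofReal_mul (by positivity), ← ENNReal.ofReal_mul (by positivity),
          ← ENNReal.ofReal_mul (by positivity), ← ENNReal.ofReal_add (by positivity) (by positivity)]
        congr 1
        field_simp
  · rw [← ENNReal.ofReal_mul (by positivity), ← ENNReal.ofReal_mul (by positivity)]
    ring_nf

theorem decay_rescale_le {n γ t r d δ : ℝ} (hn : 0 < n) (hγ : 0 < γ) (ht : 0 < t) (hr : 0 < r)
    (hrd : r ≤ d) (hδ0 : 0 ≤ δ) (hδ : δ ≤ r) :
    t ^ (-n) * (δ / t) ^ γ * (1 + d / t) ^ (-n - 2 * γ) ≤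
      2 ^ (n + γ) * (r ^ (-n) * (1 + d / r) ^ (-n - γ)) := by
  have hd : 0 < d := hr.trans_le hrd
  have h1 : 1 ≤ d / r := (one_le_div hr).2 hrd
  calc t ^ (-n) * (δ / t) ^ γ * (1 + d / t) ^ (-n - 2 * γ)
      ≤ t ^ (-n) * (r / t) ^ γ * (1 + d / t) ^ (-n - γ) := by
        gcongr ?_ * ?_ * ?_
        · exact Real.rpow_le_rpow (by positivity) (by gcongr) hγ.le
        · exact Real.rpow_le_rpow_of_exponent_le (by simpa using by positivity) (by linarith)
    _ ≤ t ^ (-n) * (r / t) ^ γ * (d / t) ^ (-n - γ) := by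
        gcongr ?_ * ?_
        exact Real.rpow_le_rpow_of_nonpos (by positivity) (by linarith) (by linarith)
    _ = r ^ (-n) * (d / r) ^ (-n - γ) := by
        rw [Real.div_rpow hr.le ht.le, Real.div_rpow hd.le ht.le, Real.div_rpow hd.le hr.le,
          Real.rpow_sub ht, Real.rpow_sub hr]
        field_simp
    _ ≤ r ^ (-n) * ((1 + d / r) / 2) ^ (-n - γ) := by
        gcongr ?_ * ?_
        exact Real.rpow_le_rpow_of_nonpos (by positivity) (by linarith) (by linarith)
    _ = _ := by
        rw [Real.div_rpow (by positivity) (by norm_num), show n + γ = -(-n - γ) by ring,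
          Real.rpow_neg (zero_le_two (α := ℝ))]
        ring

/-- Decay of `K_* a` away from the support of a function `a` with vanishing integral. -/
theorem enorm_maxOp_le_of_integral_eq_zero (m : Measure X) {n γ r C₁ C₃ : ℝ} (hn : 0 < n)
    (hγ : 0 < γ) (hr : 0 < r) (hC₃ : 0 ≤ C₃) {K : ℝ → X → X → ℝ}
    (hKm : ∀ t x, Measurable (K t x))
    (hsize : ∀ t ∈ Ioc (0:ℝ) 1, ∀ x y,
      |K t x y| ≤ C₁ * (t ^ (-n) * (1 + dist x y / t) ^ (-n - γ)))
    (hsmooth : ∀ t ∈ Ioc (0:ℝ) 1, ∀ x y z, 4 * dist y z ≤ dist x y → |K t x y - K t x z| ≤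
      C₃ * (t ^ (-n) * (dist y z / t) ^ γ * (1 + dist x y / t) ^ (-n - 2 * γ)))
    (hC₁ : 0 ≤ C₁) {a : X → ℝ} (ha : Integrable a m) (ha0 : ∫ y, a y ∂m = 0) {x₀ x : X}
    (hball : ∀ y, y ∉ ball x₀ r → a y = 0) (hx : 4 * r ≤ dist x x₀) :
    ‖maxOp m K a x‖ₑ ≤ ENNReal.ofReal (C₃ * 2 ^ (n + γ)) *
      (ENNReal.ofReal (r ^ (-n) * (1 + dist x₀ x / r) ^ (-n - γ)) * ∫⁻ y, ‖a y‖ₑ ∂m) := by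
  refine enorm_maxOp_le fun t ht => ?_
  have hint : Integrable (fun y => K t x y * a y) m := by
    refine ha.bdd_mul (c := C₁ * t ^ (-n)) (hKm t x).aestronglyMeasurable (ae_of_all _ fun y => ?_)
    refine (hsize t ht x y).trans ?_
    have := ht.1
    have h1 : (1 + dist x y / t) ^ (-n - γ) ≤ 1 :=
      Real.rpow_le_one_of_one_le_of_nonpos (by simpa using by positivity) (by linarith)
    gcongr
    exact mul_le_of_le_one_right (by positivity) h1
  have heq : ∫ y, K t x y * a y ∂m = ∫ y, (K t x y - K t x x₀) * a y ∂m := by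
    simp_rw [sub_mul]
    rw [integral_sub hint (ha.const_mul _), integral_const_mul, ha0, mul_zero, sub_zero]
  rw [heq]
  refine (enorm_integral_le_lintegral_enorm _).trans ?_
  rw [← mul_assoc, ← ENNReal.ofReal_mul (by positivity),
    ← lintegral_const_mul' _ _ ENNReal.ofReal_ne_top]
  refine lintegral_mono fun y => ?_
  by_cases hy : y ∈ ball x₀ r
  · rw [enorm_mul]
    gcongr
    rw [← ofReal_norm, Real.norm_eq_abs, abs_sub_comm]
    refine ENNReal.ofReal_le_ofReal ?_
    rw [mem_ball, dist_comm] at hy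
    refine (hsmooth t ht x x₀ y (by linarith)).trans ?_
    rw [mul_assoc C₃, dist_comm x₀ x]
    refine mul_le_mul_of_nonneg_left ?_ hC₃
    exact decay_rescale_le hn hγ ht.1 hr (by linarith) dist_nonneg hy.le
  · simp [hball y hy]

theorem maxOp_eq_zero_of_dist (m : Measure X) {lam r : ℝ} {K : ℝ → X → X → ℝ}
    (hsupp : ∀ t ∈ Ioc (0:ℝ) 1, ∀ x y, lam < dist x y → K t x y = 0) {a : X → ℝ} {x₀ x : X}
    (hball : ∀ y, y ∉ ball x₀ r → a y = 0) (hx : lam + r ≤ dist x x₀) : maxOp m K a x = 0 := by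
  refine enorm_eq_zero.1 (le_zero_iff.1 (enorm_maxOp_le fun t ht => ?_))
  have h0 : ∀ y, K t x y * a y = 0 := fun y => by
    by_cases hy : y ∈ ball x₀ r
    · rw [mem_ball] at hy
      rw [hsupp t ht x y (by linarith [dist_triangle x y x₀]), zero_mul]
    · rw [hball y hy, mul_zero]
  simp [h0]

/-- The squared `L²` norm of a 2-atom. -/
theorem lintegral_sq_le_of_eLpNorm_le (m : Measure X) {D r n : ℝ} (hD : 0 < D) (hr : 0 < r)
    {x₀ : X} (hB : ENNReal.ofReal (D⁻¹ * r ^ n) ≤ m (ball x₀ r)) {a : X → ℝ}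
    (ha : eLpNorm a 2 m ≤ m (ball x₀ r) ^ ((2:ℝ≥0∞)⁻¹.toReal - 1)) :
    ∫⁻ y, ‖a y‖ₑ ^ 2 ∂m ≤ ENNReal.ofReal (D * r ^ (-n)) := by
  have h := eLpNorm_nnreal_pow_eq_lintegral (f := a) (μ := m) (p := 2) two_ne_zero
  simp only [NNReal.coe_ofNat, ENNReal.rpow_ofNat, ENNReal.coe_ofNat] at h
  calc ∫⁻ y, ‖a y‖ₑ ^ 2 ∂m = eLpNorm a 2 m ^ 2 := h.symm
    _ ≤ (m (ball x₀ r) ^ ((2:ℝ≥0∞)⁻¹.toReal - 1)) ^ 2 := by gcongr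
    _ = (m (ball x₀ r))⁻¹ := by
        rw [← ENNReal.rpow_mul_natCast, ENNReal.toReal_inv, ← ENNReal.rpow_neg_one]
        norm_num
    _ ≤ (ENNReal.ofReal (D⁻¹ * r ^ n))⁻¹ := by gcongr
    _ = _ := by
        rw [← ENNReal.ofReal_inv_of_pos (by positivity), mul_inv, inv_inv, Real.rpow_neg hr.le]

/-- Uniform `L¹` bounds for the maximal operator of a `lam`-LAI on 2-atoms at scale `lam`. -/
theorem statement14 (m : Measure X) (n γ lam : ℝ) (hn : 0 < n) (hγ : γ ∈ Ioc (0:ℝ) 1)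
    (hlam : 0 < lam) (hX : UnifLocAhlfors m n)
    (K : ℝ → X → X → ℝ) (hK : IsLAI n γ lam K) :
    ∃ C : ℝ, 0 < C ∧ ∀ a : X → ℝ, IsAtomAtScale m 2 lam a →
      eLpNorm (maxOp m K a) 1 m ≤ ENNReal.ofReal C := by
  obtain ⟨hKm, hK0, C₁, C₂, C₃, hC₁, -, hC₃, hK⟩ := hK
  have hγ0 := hγ.1
  have hKm' : ∀ t x, Measurable (K t x) := fun t x =>
    hKm.comp (measurable_const.prodMk (measurable_const.prodMk measurable_id))
  have hsupp : ∀ t ∈ Ioc (0:ℝ) 1, ∀ x y, lam < dist x y → K t x y = 0 := fun t ht x y =>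
    (hK t ht x y y (by simpa using add_nonneg ht.1.le dist_nonneg)).1
  have hsize : ∀ t ∈ Ioc (0:ℝ) 1, ∀ x y,
      |K t x y| ≤ C₁ * (t ^ (-n) * (1 + dist x y / t) ^ (-n - γ)) := fun t ht x y => by
    rw [abs_of_nonneg (hK0 t ht x y), ← mul_assoc]
    exact (hK t ht x y y (by simpa using add_nonneg ht.1.le dist_nonneg)).2.1
  have hsmooth : ∀ t ∈ Ioc (0:ℝ) 1, ∀ x y z, 4 * dist y z ≤ dist x y → |K t x y - K t x z| ≤
      C₃ * (t ^ (-n) * (dist y z / t) ^ γ * (1 + dist x y / t) ^ (-n - 2 * γ)) :=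
    fun t ht x y z h => by
      simpa only [mul_assoc] using (hK t ht x y z (by linarith [ht.1])).2.2.2
  set R : ℝ := 1 + 8 * lam with hR
  obtain ⟨D, hD, hAhl⟩ := hX (6 * R) (by positivity)
  have hup : ∀ (x : X) (r : ℝ), 0 < r → r ≤ 6 * R → m (ball x r) ≤ ENNReal.ofReal (D * r ^ n) :=
    fun x r h0 h1 => (hAhl x r h0 h1).2
  have hS := decayConst_pos n hγ0
  set S := decayConst n γ
  set c : ℝ := C₁ * ((D + 1) * S) with hc
  refine ⟨c * D * 4 ^ n + 2 * c * D ^ 2 * 6 ^ n + C₃ * 2 ^ (n + γ) * (D * S * (2 * D)),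
    by positivity, ?_⟩
  rintro a ⟨ha, x₀, r, hr, hball, ha2, hcase⟩
  have hrlam : r ≤ lam := hcase.elim (fun h => h.1) (fun h => h.le)
  have hrn : 0 < r ^ (-n) := by positivity
  have hsq : ∫⁻ y, ‖a y‖ₑ ^ 2 ∂m ≤ ENNReal.ofReal (D * r ^ (-n)) :=
    lintegral_sq_le_of_eLpNorm_le m hD hr (hAhl x₀ r hr (by linarith)).1 ha2
  have hnear : ∫⁻ x in ball x₀ (4 * r), ‖maxOp m K a x‖ₑ ∂m ≤
      ENNReal.ofReal (c * D * 4 ^ n + 2 * c * D ^ 2 * 6 ^ n) := by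
    calc _ ≤ ENNReal.ofReal (c * r ^ (-n)) * m (ball x₀ (4 * r)) +
          ENNReal.ofReal (2 * c * D * 6 ^ n / r ^ (-n)) * ∫⁻ y, ‖a y‖ₑ ^ 2 ∂m :=
          setLIntegral_enorm_maxOp_le m hn hγ0 hC₁ (by linarith) (by linarith) hD hrn hup hsupp hsize
            ha.aemeasurable (ne_top_of_le_ne_top ENNReal.ofReal_ne_top hsq) _
      _ ≤ ENNReal.ofReal (c * r ^ (-n)) * ENNReal.ofReal (D * (4 * r) ^ n) +
          ENNReal.ofReal (2 * c * D * 6 ^ n / r ^ (-n)) * ENNReal.ofReal (D * r ^ (-n)) := by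
          gcongr
          exact hup _ _ (by positivity) (by linarith)
      _ = _ := by
          rw [← ENNReal.ofReal_mul (by positivity), ← ENNReal.ofReal_mul (by positivity),
            ← ENNReal.ofReal_add (by positivity) (by positivity), Real.mul_rpow (by norm_num) hr.le,
            Real.rpow_neg hr.le]
          congr 1
          field_simp
  have hL1 : ∫⁻ y, ‖a y‖ₑ ∂m ≤ ENNReal.ofReal (2 * D) := by
    calc ∫⁻ y, ‖a y‖ₑ ∂m = ∫⁻ y in ball x₀ r, ‖a y‖ₑ ∂m := by
          rw [← lintegral_indicator measurableSet_ball]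
          congr with y
          by_cases hy : y ∈ ball x₀ r
          · rw [indicator_of_mem hy]
          · rw [indicator_of_notMem hy, hball y hy, enorm_zero]
      _ ≤ _ := setLIntegral_le_add_setLIntegral_sq m hrn _ _
      _ ≤ ENNReal.ofReal (r ^ (-n)) * ENNReal.ofReal (D * r ^ n) +
          ENNReal.ofReal (r ^ (-n))⁻¹ * ENNReal.ofReal (D * r ^ (-n)) := by
          gcongr
          · exact hup _ _ hr (by linarith)
          · exact (setLIntegral_le_lintegral _ _).trans hsq
      _ = _ := by
          rw [← ENNReal.ofReal_mul (by positivity), ← ENNReal.ofReal_mul (by positivity),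
            ← ENNReal.ofReal_add (by positivity) (by positivity), Real.rpow_neg hr.le]
          congr 1
          field_simp
          ring
  have hfar : ∫⁻ x in (ball x₀ (4 * r))ᶜ, ‖maxOp m K a x‖ₑ ∂m ≤
      ENNReal.ofReal (C₃ * 2 ^ (n + γ) * (D * S * (2 * D))) := by
    calc _ ≤ ∫⁻ x in (ball x₀ (4 * r))ᶜ, (closedBall x₀ (R / 2)).indicator (fun x =>
          ENNReal.ofReal (C₃ * 2 ^ (n + γ)) *
          (ENNReal.ofReal (r ^ (-n) * (1 + dist x₀ x / r) ^ (-n - γ)) * ∫⁻ y, ‖a y‖ₑ ∂m)) x ∂m := by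
          refine setLIntegral_mono' measurableSet_ball.compl fun x hx => ?_
          rw [mem_compl_iff, mem_ball, not_lt] at hx
          by_cases hxR : x ∈ closedBall x₀ (R / 2) ∧ dist x x₀ < lam + r
          · rw [indicator_of_mem hxR.1]
            rcases hcase with ⟨-, ha0⟩ | hrl
            · exact enorm_maxOp_le_of_integral_eq_zero m hn hγ0 hr hC₃.le hKm' hsize hsmooth hC₁.le
                ha ha0 hball hx
            · linarith [hxR.2]
          · have hfar : lam + r ≤ dist x x₀ := by
              by_contra! h
              exact hxR ⟨by rw [mem_closedBall]; linarith, h⟩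
            simp [maxOp_eq_zero_of_dist m hsupp hball hfar]
      _ ≤ _ := setLIntegral_le_lintegral _ _
      _ = ENNReal.ofReal (C₃ * 2 ^ (n + γ)) * ((∫⁻ x in closedBall x₀ (R / 2),
          ENNReal.ofReal (r ^ (-n) * (1 + dist x₀ x / r) ^ (-n - γ)) * 1 ∂m) *
            ∫⁻ y, ‖a y‖ₑ ∂m) := by
          have htop := ne_top_of_le_ne_top ENNReal.ofReal_ne_top hL1
          rw [lintegral_indicator measurableSet_closedBall,
            lintegral_const_mul' _ _ ENNReal.ofReal_ne_top, lintegral_mul_const' _ _ htop]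
          simp only [mul_one]
      _ ≤ ENNReal.ofReal (C₃ * 2 ^ (n + γ)) *
          ((ENNReal.ofReal D * ENNReal.ofReal S) * ENNReal.ofReal (2 * D)) := by
          gcongr
          refine setLIntegral_closedBall_decay_mul_le m hn hγ0 hr (by linarith) x₀
            aemeasurable_const fun ρ hρ hρR => ?_
          rw [setLIntegral_one, ← ENNReal.ofReal_mul hD.le]
          exact hup _ _ hρ (by linarith)
      _ = _ := by
          rw [← ENNReal.ofReal_mul hD.le, ← ENNReal.ofReal_mul (by positivity),
            ← ENNReal.ofReal_mul (by positivity)]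
  rw [eLpNorm_one_eq_lintegral_enorm, ← lintegral_add_compl _ (measurableSet_ball (x := x₀)
    (ε := 4 * r)), ENNReal.ofReal_add (by positivity) (by positivity)]
  exact add_le_add hnear hfar

end
end

section
/- Let (X,d,m) be a uniformly locally n-Ahlfors metric measure space with n > 0. Then for every λ > 0 there exists a constant C > 0 such that ‖I_λ f‖_{L¹(X)} ≤ C ‖f‖_{L¹(X)} for every f ∈ L¹(X). -/
open MeasureTheory Metric Set ENNReal

noncomputable section

variable {X : Type*} [MetricSpace X] [MeasurableSpace X] [BorelSpace X]

/-- If the `δ`-balls centred at the points of a set are all charged by an s-finite measure, then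
the set is covered by countably many `2 * δ`-balls. -/
lemma exists_countable_dist_lt_of_measure_ball_pos (μ : Measure X) [SFinite μ] {δ : ℝ}
    (hδ : 0 < δ) :
    ∃ S : Set X, S.Countable ∧ ∀ x, 0 < μ (ball x δ) → ∃ s ∈ S, dist x s < 2 * δ := by
  obtain ⟨u, hut, hdisj, hcov⟩ := Vitali.exists_disjoint_subfamily_covering_enlargement
    (fun x : X => ball x δ) {x | 0 < μ (ball x δ)} (fun _ => (1 : ℝ)) 2 one_lt_two
    (fun _ _ => zero_le_one) 1 (fun _ _ => le_rfl) (fun x _ => ⟨x, mem_ball_self hδ⟩)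
  refine ⟨u, ?_, fun x hx => ?_⟩
  · have h := Measure.countable_meas_pos_of_disjoint_iUnion (μ := μ)
      (As := fun x : u => ball (x : X) δ) (fun _ => measurableSet_ball)
      (fun a b hab => hdisj a.2 b.2 (Subtype.coe_injective.ne hab))
    have huniv : {i : u | 0 < μ (ball (i : X) δ)} = univ := eq_univ_of_forall fun i => hut i.2
    rw [huniv, countable_univ_iff] at h
    exact countable_coe_iff.1 h
  · obtain ⟨s, hs, ⟨z, hzx, hzs⟩, -⟩ := hcov x hx
    refine ⟨s, hs, ?_⟩
    rw [mem_ball] at hzx hzs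
    linarith [dist_triangle_left x s z]

namespace UnifLocAhlfors

variable {m : Measure X} {n : ℝ}

lemma measure_ball_lt_top {Y : Type*} [MetricSpace Y] [MeasurableSpace Y] {μ : Measure Y}
    (hY : UnifLocAhlfors μ n) (x : Y) {r : ℝ} (hr : 0 < r) :
    μ (ball x r) < ∞ := by
  obtain ⟨D, -, h⟩ := hY r hr
  exact (h x r hr le_rfl).2.trans_lt ofReal_lt_top

lemma measure_ball_pos {Y : Type*} [MetricSpace Y] [MeasurableSpace Y] {μ : Measure Y}
    (hY : UnifLocAhlfors μ n) (x : Y) {r : ℝ} (hr : 0 < r) :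
    0 < μ (ball x r) := by
  obtain ⟨D, hD, h⟩ := hY r hr
  exact lt_of_lt_of_le (ofReal_pos.2 (by positivity)) (h x r hr le_rfl).1

lemma isSeparable_ball (hX : UnifLocAhlfors m n) (x : X) {r : ℝ} (hr : 0 < r) :
    TopologicalSpace.IsSeparable (ball x r) := by
  suffices h : ∀ ε > 0, ∃ t : Set X, t.Countable ∧ ball x r ⊆ ⋃ y ∈ t, closedEBall y ε by
    obtain ⟨t, -, htc, ht⟩ := EMetric.subset_countable_closure_of_almost_dense_set _ h
    exact ⟨t, htc, ht⟩
  intro ε hε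
  obtain ⟨δ, -, hδ, hδε⟩ := ENNReal.lt_iff_exists_real_btwn.1 hε
  rw [ofReal_pos] at hδ
  have : IsFiniteMeasure (m.restrict (ball x (r + δ / 2))) :=
    ⟨by simpa using hX.measure_ball_lt_top x (by positivity)⟩
  obtain ⟨S, hS, hcov⟩ := exists_countable_dist_lt_of_measure_ball_pos
    (m.restrict (ball x (r + δ / 2))) (half_pos hδ)
  refine ⟨S, hS, fun y hy => ?_⟩
  have hsub : ball y (δ / 2) ⊆ ball x (r + δ / 2) :=
    ball_subset_ball' (by linarith [mem_ball.1 hy])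
  obtain ⟨s, hs, hys⟩ := hcov y <| by
    rw [Measure.restrict_apply measurableSet_ball, inter_eq_left.2 hsub]
    exact hX.measure_ball_pos y (half_pos hδ)
  refine mem_biUnion hs ?_
  rw [mem_closedEBall, edist_dist]
  exact (ofReal_le_ofReal (by linarith)).trans hδε.le

lemma isLocallyFiniteMeasure_comap_coe (hX : UnifLocAhlfors m n) {U : Set X}
    (hU : MeasurableSet U) :
    IsLocallyFiniteMeasure (m.comap ((↑) : U → X)) := by
  refine ⟨fun x => ⟨(↑) ⁻¹' ball (x : X) 1,
    continuous_subtype_val.continuousAt.preimage_mem_nhds (ball_mem_nhds _ one_pos), ?_⟩⟩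
  rw [(MeasurableEmbedding.subtype_coe hU).comap_apply]
  exact (measure_mono (image_preimage_subset _ _)).trans_lt (hX.measure_ball_lt_top _ one_pos)

end UnifLocAhlfors

/-- Schur's test in `L¹` for a kernel depending only on the distance. -/
lemma lintegral_lintegral_dist_mul_le [SecondCountableTopology X] (μ : Measure X) [SFinite μ]
    {κ : ℝ → ℝ≥0∞} (hκ : Measurable κ) {C : ℝ≥0∞} (hC : ∀ y, ∫⁻ x, κ (dist x y) ∂μ ≤ C)
    {g : X → ℝ≥0∞} (hg : AEMeasurable g μ) :
    ∫⁻ x, ∫⁻ y, κ (dist x y) * g y ∂μ ∂μ ≤ C * ∫⁻ y, g y ∂μ := by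
  have hmeas : Measurable fun p : X × X => κ (dist p.1 p.2) := hκ.comp measurable_dist
  rw [lintegral_lintegral_swap (hmeas.aemeasurable.mul hg.comp_snd)]
  calc ∫⁻ y, ∫⁻ x, κ (dist x y) * g y ∂μ ∂μ
      = ∫⁻ y, (∫⁻ x, κ (dist x y) ∂μ) * g y ∂μ := by
        refine lintegral_congr fun y => lintegral_mul_const _ ?_
        exact hκ.comp (measurable_id.dist measurable_const)
    _ ≤ ∫⁻ y, C * g y ∂μ := lintegral_mono fun y => mul_le_mul_left (hC y) _
    _ = C * ∫⁻ y, g y ∂μ := lintegral_const_mul'' _ hg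

/-- The truncated Riesz kernel `d ↦ d ^ (1 - n)` on `d < lam`. -/
def truncRiesz (n lam : ℝ) : ℝ → ℝ≥0∞ :=
  (Iio lam).indicator fun d => ENNReal.ofReal (1 / d ^ (n - 1))

lemma measurable_truncRiesz (n lam : ℝ) : Measurable (truncRiesz n lam) :=
  Measurable.indicator (by fun_prop) measurableSet_Iio

lemma exists_dyadic_rpow_le (n : ℝ) {lam d : ℝ} (hd : 0 ≤ d) (hdl : d < lam) :
    ∃ k : ℕ, d < 2 * lam * (1 / 2) ^ k ∧
      1 / d ^ (n - 1) ≤ 4 ^ |n - 1| * (2 * lam * (1 / 2) ^ k) ^ (1 - n) := by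
  have hlam : 0 < lam := hd.trans_lt hdl
  rcases hd.eq_or_lt with rfl | hd
  · refine ⟨0, by simpa using hlam, ?_⟩
    by_cases hn : n - 1 = 0
    · have h1n : 1 - n = 0 := by linarith
      simp [hn, h1n]
    · rw [Real.zero_rpow hn, _root_.div_zero]
      positivity
  · obtain ⟨k, hk, hk'⟩ := exists_nat_pow_near_of_lt_one (div_pos hd hlam)
      ((div_le_one hlam).2 hdl.le) (by norm_num : (0 : ℝ) < 1 / 2) (by norm_num)
    set ρ := 2 * lam * (1 / 2 : ℝ) ^ k with hρ
    have hρ0 : 0 < ρ := by positivity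
    rw [lt_div_iff₀ hlam, pow_succ] at hk
    rw [div_le_iff₀ hlam] at hk'
    have hdρ : d ≤ ρ / 2 := by rw [hρ]; linarith
    have hρd : ρ / 4 ≤ d := by rw [hρ]; linarith
    refine ⟨k, by linarith, ?_⟩
    have ht0 : 0 < d / ρ := by positivity
    have ht : (d / ρ) ^ (1 - n) ≤ 4 ^ |n - 1| := calc
      (d / ρ) ^ (1 - n) ≤ (d / ρ) ^ (-|n - 1|) :=
        Real.rpow_le_rpow_of_exponent_ge ht0 ((div_le_one hρ0).2 (by linarith))
          (by linarith [le_abs_self (n - 1)])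
      _ ≤ (1 / 4) ^ (-|n - 1|) :=
        Real.rpow_le_rpow_of_nonpos (by norm_num) ((le_div_iff₀ hρ0).2 (by linarith))
          (neg_nonpos.2 (abs_nonneg _))
      _ = 4 ^ |n - 1| := by
        rw [one_div, Real.inv_rpow (by norm_num), Real.rpow_neg (by norm_num), inv_inv]
    calc 1 / d ^ (n - 1) = d ^ (1 - n) := by
          rw [one_div, ← Real.rpow_neg hd.le, neg_sub]
      _ = (d / ρ) ^ (1 - n) * ρ ^ (1 - n) := by
          rw [← Real.mul_rpow ht0.le hρ0.le, div_mul_cancel₀ _ hρ0.ne']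
      _ ≤ _ := by gcongr

/-- Uniform bound for the `L¹` norm of the truncated Riesz kernel. -/
lemma UnifLocAhlfors.exists_lintegral_truncRiesz_le {m : Measure X} {n : ℝ}
    (hX : UnifLocAhlfors m n) {lam : ℝ} (hlam : 0 < lam) :
    ∃ C : ℝ, 0 < C ∧ ∀ y, ∫⁻ x, truncRiesz n lam (dist x y) ∂m ≤ ENNReal.ofReal C := by
  obtain ⟨D, hD, hball⟩ := hX (2 * lam) (by positivity)
  let ρ : ℕ → ℝ := fun k => 2 * lam * (1 / 2) ^ k
  have hρ : ∀ k, 0 < ρ k := fun k => by positivity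
  let c : ℕ → ℝ := fun k => 4 ^ |n - 1| * ρ k ^ (1 - n)
  have hc : ∀ k, 0 ≤ c k := fun k => by have := hρ k; positivity
  have hgeom : Summable fun k => 4 ^ |n - 1| * D * ρ k :=
    (summable_geometric_two.mul_left _).mul_left _
  refine ⟨∑' k, 4 ^ |n - 1| * D * ρ k,
    hgeom.tsum_pos (fun k => by have := hρ k; positivity) 0 (by have := hρ 0; positivity),
    fun y => ?_⟩
  calc ∫⁻ x, truncRiesz n lam (dist x y) ∂m
      ≤ ∫⁻ x, ∑' k, (ball y (ρ k)).indicator (fun _ => ENNReal.ofReal (c k)) x ∂m := by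
        refine lintegral_mono fun x => ?_
        refine indicator_apply_le' (fun hx => ?_) (fun _ => zero_le)
        obtain ⟨k, hk, hle⟩ := exists_dyadic_rpow_le n dist_nonneg hx
        refine (ofReal_le_ofReal hle).trans (le_trans ?_ (ENNReal.le_tsum k))
        rw [indicator_of_mem (mem_ball.2 hk)]
    _ = ∑' k, ENNReal.ofReal (c k) * m (ball y (ρ k)) := by
        rw [lintegral_tsum fun k =>
          (measurable_const.indicator measurableSet_ball).aemeasurable]
        exact tsum_congr fun k => lintegral_indicator_const measurableSet_ball _
    _ ≤ ∑' k, ENNReal.ofReal (4 ^ |n - 1| * D * ρ k) := by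
        refine ENNReal.tsum_le_tsum fun k => ?_
        have hρle : ρ k ≤ 2 * lam := mul_le_of_le_one_right (by positivity)
          (pow_le_one₀ (by norm_num) (by norm_num))
        refine (mul_le_mul_right (hball y (ρ k) (hρ k) hρle).2 _).trans_eq ?_
        rw [← ofReal_mul (hc k)]
        congr 1
        have h1 : ρ k ^ (1 - n) * ρ k ^ n = ρ k := by
          rw [← Real.rpow_add (hρ k), sub_add_cancel, Real.rpow_one]
        linear_combination 4 ^ |n - 1| * D * h1
    _ = ENNReal.ofReal (∑' k, 4 ^ |n - 1| * D * ρ k) :=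
        (ofReal_tsum_of_nonneg (fun k => by have := hρ k; positivity) hgeom).symm

lemma setLIntegral_ball_ofReal_eq (m : Measure X) (n lam : ℝ) (f : X → ℝ) (x : X) :
    ∫⁻ y in ball x lam, ENNReal.ofReal (|f y| / dist x y ^ (n - 1)) ∂m =
      ∫⁻ y, truncRiesz n lam (dist x y) * ‖f y‖ₑ ∂m := by
  rw [← lintegral_indicator measurableSet_ball]
  refine lintegral_congr fun y => ?_
  by_cases hy : y ∈ ball x lam
  · have hd : dist x y ∈ Iio lam := mem_ball'.1 hy
    rw [indicator_of_mem hy, truncRiesz, indicator_of_mem hd, Real.enorm_eq_ofReal_abs,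
      ← ofReal_mul (by positivity)]
    congr 1
    ring
  · have hd : dist x y ∉ Iio lam := fun h => hy (mem_ball'.2 h)
    rw [indicator_of_notMem hy, truncRiesz, indicator_of_notMem hd, zero_mul]

/-- The double integral defining `‖I_λ f‖₁` is carried by a separable open set, even when the
ambient space is not separable. -/
lemma UnifLocAhlfors.exists_isSeparable_lintegral_le {m : Measure X} {n : ℝ}
    (hX : UnifLocAhlfors m n) {lam : ℝ} (hlam : 0 < lam) {f : X → ℝ} (hf : Integrable f m) :
    ∃ U : Set X, IsOpen U ∧ TopologicalSpace.IsSeparable U ∧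
      ∫⁻ x, ∫⁻ y, truncRiesz n lam (dist x y) * ‖f y‖ₑ ∂m ∂m ≤
        ∫⁻ x in U, ∫⁻ y in U, truncRiesz n lam (dist x y) * ‖f y‖ₑ ∂m ∂m := by
  have : IsFiniteMeasure (m.withDensity fun y => ‖f y‖ₑ) :=
    isFiniteMeasure_withDensity hf.2.ne
  obtain ⟨S, hS, hcov⟩ := exists_countable_dist_lt_of_measure_ball_pos
    (m.withDensity fun y => ‖f y‖ₑ) hlam
  have hSc : Countable S := hS.to_subtype
  have hopen : IsOpen (⋃ s : S, ball (s : X) (3 * lam)) := isOpen_iUnion fun _ => isOpen_ball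
  refine ⟨⋃ s : S, ball (s : X) (3 * lam), hopen,
    .iUnion fun s => hX.isSeparable_ball s (by positivity), ?_⟩
  rw [← lintegral_indicator hopen.measurableSet]
  refine lintegral_mono fun x => ?_
  rcases eq_zero_or_pos ((m.withDensity fun y => ‖f y‖ₑ) (ball x lam)) with h0 | hpos
  · rw [withDensity_apply _ measurableSet_ball,
      lintegral_eq_zero_iff' hf.1.enorm.restrict, Filter.EventuallyEq,
      ae_restrict_iff' measurableSet_ball] at h0
    refine (lintegral_eq_zero_of_ae_eq_zero ?_).trans_le zero_le
    filter_upwards [h0] with y hy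
    by_cases hxy : y ∈ ball x lam
    · simp [hy hxy]
    · have hd : dist x y ∉ Iio lam := fun h => hxy (mem_ball'.2 h)
      simp [truncRiesz, indicator_of_notMem hd]
  · obtain ⟨s, hs, hxs⟩ := hcov x hpos
    have hxU : x ∈ ⋃ s : S, ball (s : X) (3 * lam) :=
      mem_iUnion.2 ⟨⟨s, hs⟩, mem_ball.2 (by linarith)⟩
    rw [indicator_of_mem hxU, ← lintegral_indicator hopen.measurableSet]
    refine lintegral_mono fun y => ?_
    by_cases hxy : dist x y ∈ Iio lam
    · rw [indicator_of_mem]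
      refine mem_iUnion.2 ⟨⟨s, hs⟩, mem_ball.2 ?_⟩
      have : dist x y < lam := hxy
      linarith [dist_triangle_left y s x]
    · simp [truncRiesz, indicator_of_notMem hxy]

/-- `L¹` boundedness of the local Riesz-type potential on a uniformly locally
`n`-Ahlfors space. -/
theorem statement16 (m : Measure X) (n : ℝ) (hn : 0 < n) (hX : UnifLocAhlfors m n)
    (lam : ℝ) (hlam : 0 < lam) :
    ∃ C : ℝ, 0 < C ∧ ∀ f : X → ℝ, Integrable f m →
      (∫⁻ x, ∫⁻ y in ball x lam,
          ENNReal.ofReal (|f y| / dist x y ^ (n - 1)) ∂m ∂m)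
        ≤ ENNReal.ofReal C * eLpNorm f 1 m := by
  obtain ⟨C, hC, hCle⟩ := hX.exists_lintegral_truncRiesz_le hlam
  refine ⟨C, hC, fun f hf => ?_⟩
  obtain ⟨U, hUo, hUs, hU⟩ := hX.exists_isSeparable_lintegral_le hlam hf
  have hUm := hUo.measurableSet
  have : SecondCountableTopology U := hUs.secondCountableTopology
  have : IsLocallyFiniteMeasure (m.comap ((↑) : U → X)) :=
    hX.isLocallyFiniteMeasure_comap_coe hUm
  have hfU : AEMeasurable (fun y : U => ‖f y‖ₑ) (m.comap ((↑) : U → X)) := by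
    refine AEMeasurable.comp_measurable (g := fun y => ‖f y‖ₑ) ?_ measurable_subtype_coe
    rw [map_comap_subtype_coe hUm]
    exact hf.1.enorm.restrict
  have hCU : ∀ y : U, ∫⁻ x : U, truncRiesz n lam (dist x y) ∂(m.comap ((↑) : U → X)) ≤
      ENNReal.ofReal C := fun y =>
    (lintegral_subtype_comap hUm fun x => truncRiesz n lam (dist x (y : X))).trans_le
      ((setLIntegral_le_lintegral _ _).trans (hCle y))
  simp_rw [setLIntegral_ball_ofReal_eq]
  rw [eLpNorm_one_eq_lintegral_enorm]
  calc _ ≤ ∫⁻ x in U, ∫⁻ y in U, truncRiesz n lam (dist x y) * ‖f y‖ₑ ∂m ∂m := hU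
    _ = ∫⁻ x : U, ∫⁻ y : U, truncRiesz n lam (dist x y) * ‖f y‖ₑ
          ∂(m.comap (↑)) ∂(m.comap (↑)) := by
        rw [← lintegral_subtype_comap hUm]
        exact lintegral_congr fun x => (lintegral_subtype_comap hUm
          fun y => truncRiesz n lam (dist (x : X) y) * ‖f y‖ₑ).symm
    _ ≤ ENNReal.ofReal C * ∫⁻ y : U, ‖f y‖ₑ ∂(m.comap (↑)) :=
        lintegral_lintegral_dist_mul_le _ (measurable_truncRiesz n lam) hCU hfU
    _ = ENNReal.ofReal C * ∫⁻ y in U, ‖f y‖ₑ ∂m := by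
        rw [lintegral_subtype_comap hUm fun y => ‖f y‖ₑ]
    _ ≤ ENNReal.ofReal C * ∫⁻ y, ‖f y‖ₑ ∂m := by
        gcongr
        exact Measure.restrict_le_self

end
end

section
/- For every α ∈ (0,1) there exist a Borel measurable function F : (0,∞) → ℝ and constants C, c > 0 such that: (1) 0 ≤ F(s) ≤ C s^{−α} exp(−c s^{−α/(1−α)}) for all s ∈ (0,∞); and (2) for every z ∈ ℂ with Re z > 0, exp(−z^α) = ∫₀^∞ F(s) e^{−sz} ds/s, where z^α = exp(α log z) is defined via the principal branch of the logarithm, and the integral (of a complex-valued function of s ∈ (0,∞)) is absolutely convergent. -/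
open MeasureTheory Set

noncomputable section

open Filter Topology

/-- Iterated backward difference `(1 - E)^n u`, where `E` is the unit shift. -/
def iterDiff : ℕ → (ℝ → ℝ) → ℝ → ℝ
  | 0, u => u
  | n + 1, u => fun x => iterDiff n u x - iterDiff n u (x + 1)

lemma iterDiff_linear (n : ℕ) (a b : ℝ) (u v : ℝ → ℝ) (x : ℝ) :
    iterDiff n (fun y => a * u y + b * v y) x = a * iterDiff n u x + b * iterDiff n v x := by
  induction n generalizing x with
  | zero => rfl
  | succ n ih => simp only [iterDiff, ih]; ring

lemma hasDerivAt_iterDiff (n : ℕ) {u u' : ℝ → ℝ} (h : ∀ x, 0 < x → HasDerivAt u (u' x) x)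
    {x : ℝ} (hx : 0 < x) : HasDerivAt (iterDiff n u) (iterDiff n u' x) x := by
  induction n generalizing x with
  | zero => exact h x hx
  | succ n ih =>
    exact (ih hx).sub ((ih (show 0 < x + 1 by linarith)).comp_add_const x 1)

lemma iterDiff_rpow_mul_exp_nonneg {α : ℝ} (hα : α ∈ Ioo (0:ℝ) 1) (n : ℕ) {b : ℝ} (hb : 0 ≤ b)
    {x : ℝ} (hx : 0 < x) :
    0 ≤ iterDiff n (fun y => y ^ (-b) * Real.exp (-y ^ α)) x := by
  induction n generalizing b x with
  | zero => exact mul_nonneg (Real.rpow_nonneg hx.le _) (Real.exp_pos _).le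
  | succ n ih =>
    have hd : ∀ y : ℝ, 0 < y → HasDerivAt (fun y : ℝ => y ^ (-b) * Real.exp (-y ^ α))
        ((-b) * (y ^ (-(b + 1)) * Real.exp (-y ^ α)) +
          (-α) * (y ^ (-(b + (1 - α))) * Real.exp (-y ^ α))) y := by
      intro y hy
      have h1 := Real.hasDerivAt_rpow_const (x := y) (p := -b) (Or.inl hy.ne')
      have h2 := (Real.hasDerivAt_rpow_const (x := y) (p := α) (Or.inl hy.ne')).neg.exp
      refine (h1.mul h2).congr_deriv ?_
      have e1 : -(b + 1) = -b - 1 := by ring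
      have e2 : -(b + (1 - α)) = -b + (α - 1) := by ring
      rw [e1, e2, Real.rpow_add hy]
      simp only [Pi.neg_apply]
      ring
    have hD := fun y (hy : y ∈ Ioi (0:ℝ)) => hasDerivAt_iterDiff n hd (x := y) hy
    have hanti : AntitoneOn (iterDiff n fun y => y ^ (-b) * Real.exp (-y ^ α)) (Ioi 0) := by
      apply antitoneOn_of_deriv_nonpos (convex_Ioi 0)
        (fun y hy => (hD y hy).continuousAt.continuousWithinAt)
      · rw [interior_Ioi]
        exact fun y hy => (hD y hy).differentiableAt.differentiableWithinAt
      · rw [interior_Ioi]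
        intro y hy
        rw [(hD y hy).deriv, iterDiff_linear]
        have p1 := ih (b := b + 1) (by linarith) hy
        have p2 := ih (b := b + (1 - α)) (by linarith [hα.2]) hy
        nlinarith [mul_nonneg hb p1, mul_nonneg hα.1.le p2]
    have := hanti (show x ∈ Ioi 0 from hx) (show x + 1 ∈ Ioi 0 by simp; linarith)
      (by linarith)
    simp only [iterDiff]
    linarith

lemma integrableOn_exp_mul_pow_mul {g : ℝ → ℝ} (hg : Continuous g) {C : ℝ}
    (hC : ∀ t, 0 < t → |g t| ≤ C * Real.exp t) (n : ℕ) {x : ℝ} (hx : 1 < x) :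
    IntegrableOn (fun t => Real.exp (-(t * x)) * (1 - Real.exp (-t)) ^ n * g t) (Ioi 0) := by
  have h0 : IntegrableOn (fun t => C * Real.exp (-(x - 1) * t)) (Ioi 0) :=
    (exp_neg_integrableOn_Ioi 0 (by linarith)).const_mul C
  refine h0.mono' (by fun_prop) ?_
  filter_upwards [ae_restrict_mem measurableSet_Ioi] with t ht
  have ht : 0 < t := ht
  have h1 : |1 - Real.exp (-t)| ≤ 1 := by
    rw [abs_le]
    have := Real.exp_pos (-t)
    have : Real.exp (-t) ≤ 1 := Real.exp_le_one_iff.2 (by linarith)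
    constructor <;> linarith
  rw [norm_mul, norm_mul, norm_pow, Real.norm_eq_abs, Real.norm_eq_abs, Real.norm_eq_abs,
    Real.abs_exp]
  calc Real.exp (-(t * x)) * |1 - Real.exp (-t)| ^ n * |g t|
      ≤ Real.exp (-(t * x)) * 1 * (C * Real.exp t) := by
        gcongr
        · exact pow_le_one₀ (abs_nonneg _) h1
        · exact hC t ht
    _ = C * Real.exp (-(x - 1) * t) := by
        rw [show -(x - 1) * t = -(t * x) + t by ring, Real.exp_add]; ring

lemma integral_exp_mul_pow_mul {g u : ℝ → ℝ} (hg : Continuous g) {C : ℝ}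
    (hC : ∀ t, 0 < t → |g t| ≤ C * Real.exp t)
    (hu : ∀ x, 1 < x → ∫ t in Ioi (0:ℝ), Real.exp (-(t * x)) * g t = u x)
    (n : ℕ) {x : ℝ} (hx : 1 < x) :
    ∫ t in Ioi (0:ℝ), Real.exp (-(t * x)) * (1 - Real.exp (-t)) ^ n * g t = iterDiff n u x := by
  induction n generalizing x with
  | zero => simpa [iterDiff] using hu x hx
  | succ n ih =>
    simp only [iterDiff]
    rw [← ih hx, ← ih (show 1 < x + 1 by linarith),
      ← integral_sub (integrableOn_exp_mul_pow_mul hg hC n hx)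
        (integrableOn_exp_mul_pow_mul hg hC n (by linarith))]
    congr 1
    ext t
    rw [show -(t * (x + 1)) = -(t * x) + -t by ring, Real.exp_add, pow_succ]
    ring

/-- A continuous function of exponential type whose Laplace transform has nonnegative iterated
differences is nonnegative on the positive half-line. -/
lemma nonneg_of_laplace_iterDiff_nonneg {g u : ℝ → ℝ} (hg : Continuous g) {C : ℝ}
    (hC : ∀ t, 0 < t → |g t| ≤ C * Real.exp t)
    (hu : ∀ x, 1 < x → ∫ t in Ioi (0:ℝ), Real.exp (-(t * x)) * g t = u x)
    (hpos : ∀ n x, 1 < x → 0 ≤ iterDiff n u x) {t : ℝ} (ht : 0 < t) : 0 ≤ g t := by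
  have hC0 : 0 ≤ C := by
    have := (abs_nonneg _).trans (hC 1 one_pos)
    exact nonneg_of_mul_nonneg_left this (Real.exp_pos _)
  -- the test function
  have hcont : Continuous fun x : unitInterval =>
      (x:ℝ) ^ 2 * max 0 (-g (-Real.log x)) := by
    rw [continuous_iff_continuousAt]
    intro x
    by_cases hx : (x:ℝ) = 0
    · have hb : ∀ y : unitInterval, ‖(y:ℝ) ^ 2 * max 0 (-g (-Real.log y))‖ ≤
          (C + |g 0|) * y := by
        intro y
        rcases y.2.1.eq_or_lt with h | h
        · simp [← h]
        have hlog : 0 ≤ -Real.log y := by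
          have := Real.log_nonpos y.2.1 y.2.2
          linarith
        have hgb : |g (-Real.log y)| ≤ (C + |g 0|) * Real.exp (-Real.log y) := by
          rcases hlog.eq_or_lt with h' | h'
          · rw [← h']; simp [hC0]
          · refine (hC _ h').trans ?_
            gcongr
            linarith [abs_nonneg (g 0)]
        rw [Real.exp_neg, Real.exp_log h] at hgb
        have hm : max 0 (-g (-Real.log y)) ≤ |g (-Real.log y)| :=
          max_le (abs_nonneg _) (neg_le_abs _)
        rw [Real.norm_of_nonneg (by positivity)]
        calc (y:ℝ) ^ 2 * max 0 (-g (-Real.log y))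
            ≤ (y:ℝ) ^ 2 * ((C + |g 0|) * (y:ℝ)⁻¹) := by
              gcongr
              exact hm.trans hgb
          _ = (C + |g 0|) * y := by field_simp
      rw [ContinuousAt]
      simp only [hx]
      rw [zero_pow two_ne_zero, zero_mul]
      refine squeeze_zero_norm hb ?_
      have : Continuous fun y : unitInterval => (C + |g 0|) * (y:ℝ) := by fun_prop
      simpa [hx] using this.tendsto x
    · have hl : ContinuousAt (fun x : unitInterval => Real.log x) x :=
        (Real.continuousAt_log hx).comp continuous_subtype_val.continuousAt
      have hgl : ContinuousAt (fun x : unitInterval => g (-Real.log x)) x :=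
        hg.continuousAt.comp (f := fun x : unitInterval => -Real.log x) hl.neg
      exact (continuous_subtype_val.continuousAt.pow 2).mul
        (continuousAt_const.max hgl.neg)
  set φ : C(unitInterval, ℝ) := ⟨_, hcont⟩ with hφ
  have hφ0 : ∀ x, 0 ≤ φ x := fun x => by
    simp only [hφ, ContinuousMap.coe_mk]; positivity
  -- the change of variables `t ↦ e^{-t}`, clamped to the unit interval
  set E : ℝ → unitInterval := fun t => projIcc 0 1 zero_le_one (Real.exp (-t)) with hE
  have hEc : Continuous E := continuous_projIcc.comp (by fun_prop)
  have hEt : ∀ t, 0 < t → ((E t : unitInterval) : ℝ) = Real.exp (-t) := fun t ht => by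
    rw [hE]
    simp only
    rw [projIcc_of_mem zero_le_one
      ⟨(Real.exp_pos _).le, Real.exp_le_one_iff.2 (by linarith)⟩]
  have hw : IntegrableOn (fun t => Real.exp (-(t * 2)) * g t) (Ioi 0) := by
    simpa using integrableOn_exp_mul_pow_mul hg hC 0 (x := 2) (by norm_num)
  have hint : ∀ ψ : C(unitInterval, ℝ),
      IntegrableOn (fun t => ψ (E t) * (Real.exp (-(t * 2)) * g t)) (Ioi 0) := fun ψ => by
    refine Integrable.bdd_mul (c := ‖ψ‖) hw ?_ (ae_of_all _ fun t => ψ.norm_coe_le_norm _)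
    exact (ψ.continuous.comp hEc).aestronglyMeasurable
  have hbern : ∀ n, 0 ≤ ∫ t in Ioi (0:ℝ),
      bernsteinApproximation n φ (E t) * (Real.exp (-(t * 2)) * g t) := by
    intro n
    have : ∫ t in Ioi (0:ℝ), bernsteinApproximation n φ (E t) * (Real.exp (-(t * 2)) * g t) =
        ∑ k : Fin (n + 1), φ (bernstein.z k) * (n.choose k) *
          iterDiff (n - k) u (k + 2) := by
      have hk : ∀ k : Fin (n + 1), (1:ℝ) < k + 2 := fun k => by
        have : (0:ℝ) ≤ (k:ℕ) := Nat.cast_nonneg _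
        linarith
      simp_rw [← fun k : Fin (n + 1) => integral_exp_mul_pow_mul hg hC hu (n - k) (hk k),
        ← integral_const_mul]
      rw [← integral_finsetSum]
      · refine setIntegral_congr_fun measurableSet_Ioi fun t ht => ?_
        simp only [bernsteinApproximation.apply, bernstein_apply, hEt t ht, Finset.sum_mul]
        refine Finset.sum_congr rfl fun k _ => ?_
        rw [show -(t * ((k:ℕ) + 2 : ℝ)) = (k:ℕ) * (-t) + -(t * 2) by ring, Real.exp_add,
          Real.exp_nat_mul, smul_eq_mul]
        ring
      · exact fun k _ => (integrableOn_exp_mul_pow_mul hg hC (n - k) (hk k)).const_mul _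
    rw [this]
    refine Finset.sum_nonneg fun k _ => mul_nonneg (mul_nonneg (hφ0 _) (Nat.cast_nonneg _)) ?_
    refine hpos _ _ ?_
    have : (0:ℝ) ≤ (k:ℕ) := Nat.cast_nonneg _
    linarith
  have hlim : Tendsto (fun n => ∫ t in Ioi (0:ℝ),
      bernsteinApproximation n φ (E t) * (Real.exp (-(t * 2)) * g t)) atTop
      (𝓝 (∫ t in Ioi (0:ℝ), φ (E t) * (Real.exp (-(t * 2)) * g t))) := by
    rw [tendsto_iff_norm_sub_tendsto_zero]
    have hB := (tendsto_iff_norm_sub_tendsto_zero.1 (bernsteinApproximation_uniform φ)).mul_const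
      (∫ t in Ioi (0:ℝ), ‖Real.exp (-(t * 2)) * g t‖)
    rw [zero_mul] at hB
    refine squeeze_zero (fun _ => norm_nonneg _) (fun n => ?_) hB
    rw [← integral_sub (hint _) (hint _), ← integral_const_mul]
    refine norm_integral_le_of_norm_le (hw.norm.const_mul _) (ae_of_all _ fun t => ?_)
    rw [← sub_mul, norm_mul]
    gcongr
    exact (bernsteinApproximation n φ - φ).norm_coe_le_norm (E t)
  have hge := ge_of_tendsto' hlim hbern
  have hval : ∀ t ∈ Ioi (0:ℝ), φ (E t) * (Real.exp (-(t * 2)) * g t) =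
      -(Real.exp (-(t * 2)) ^ 2 * max 0 (-g t) ^ 2) := by
    intro t ht
    have h1 : φ (E t) = Real.exp (-(t * 2)) * max 0 (-g t) := by
      simp only [hφ, ContinuousMap.coe_mk, hEt t ht, Real.log_exp, neg_neg]
      rw [← Real.exp_nat_mul]
      congr 2
      push_cast
      ring
    rw [h1]
    rcases le_total 0 (-g t) with h | h
    · rw [max_eq_right h]; ring
    · rw [max_eq_left h]; ring
  have hI := (hint φ).congr_fun hval measurableSet_Ioi
  rw [setIntegral_congr_fun measurableSet_Ioi hval, integral_neg] at hge
  have hI' : IntegrableOn (fun t => Real.exp (-(t * 2)) ^ 2 * max 0 (-g t) ^ 2) (Ioi 0) := by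
    simpa using hI.neg
  have hnn : ∀ t, 0 ≤ Real.exp (-(t * 2)) ^ 2 * max 0 (-g t) ^ 2 := fun t => by positivity
  have hz : ∫ t in Ioi (0:ℝ), Real.exp (-(t * 2)) ^ 2 * max 0 (-g t) ^ 2 = 0 :=
    le_antisymm (by linarith) (integral_nonneg hnn)
  rw [setIntegral_eq_zero_iff_of_nonneg_ae (ae_of_all _ hnn) hI'] at hz
  have := Measure.eqOn_open_of_ae_eq hz isOpen_Ioi
    (Continuous.continuousOn (by fun_prop)) continuousOn_const
    (show t ∈ Ioi (0:ℝ) from ht)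
  simp only [Pi.zero_apply, mul_eq_zero, pow_eq_zero_iff two_ne_zero, Real.exp_ne_zero,
    false_or] at this
  have := le_max_right 0 (-g t)
  linarith

lemma exists_rpow_mul_exp_neg_le {α c p : ℝ} (hα : 0 < α) (hc : 0 < c) (hp : 0 < p) :
    ∃ M, 0 < M ∧ ∀ t, 0 < t → t ^ p * Real.exp (-(c * t ^ α)) ≤ M := by
  have hq : 0 < p / α := div_pos hp hα
  refine ⟨(p / α / c) ^ (p / α), by positivity, fun t ht => ?_⟩
  have hu : 0 < t ^ α := Real.rpow_pos_of_pos ht _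
  have h1 : c * t ^ α / (p / α) ≤ Real.exp (c * t ^ α / (p / α)) := by
    linarith [Real.add_one_le_exp (c * t ^ α / (p / α))]
  have h2 := Real.rpow_le_rpow (by positivity) h1 hq.le
  rw [← Real.exp_mul, div_mul_cancel₀ _ hq.ne'] at h2
  have h3 : t ^ p = (p / α / c) ^ (p / α) * (c * t ^ α / (p / α)) ^ (p / α) := by
    rw [← Real.mul_rpow (by positivity) (by positivity),
      show p / α / c * (c * t ^ α / (p / α)) = t ^ α by field_simp, ← Real.rpow_mul ht.le,
      mul_div_cancel₀ _ hα.ne']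
  rw [h3, mul_assoc, Real.exp_neg]
  refine mul_le_of_le_one_right (by positivity) ?_
  rw [← div_eq_mul_inv]
  exact div_le_one_of_le₀ h2 (Real.exp_pos _).le

/-- The function `z ↦ exp (-z ^ α)`. -/
def stretchedExp (α : ℝ) (z : ℂ) : ℂ := Complex.exp (-(z ^ (α : ℂ)))

/-- The first derivative of `stretchedExp α`. -/
def stretchedExpDeriv (α : ℝ) (z : ℂ) : ℂ :=
  -(α * z ^ ((α : ℂ) - 1)) * stretchedExp α z

/-- The second derivative of `stretchedExp α`. -/
def stretchedExpDeriv₂ (α : ℝ) (z : ℂ) : ℂ :=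
  (α * (1 - α) * z ^ ((α : ℂ) - 1 - 1) + (α * z ^ ((α : ℂ) - 1)) ^ 2) * stretchedExp α z

lemma hasDerivAt_stretchedExp (α : ℝ) {z : ℂ} (hz : 0 < z.re) :
    HasDerivAt (stretchedExp α) (stretchedExpDeriv α z) z := by
  have hs : z ∈ Complex.slitPlane := Or.inl hz
  refine ((hasDerivAt_id z).cpow_const (c := (α : ℂ)) hs).neg.cexp.congr_deriv ?_
  simp [stretchedExpDeriv, stretchedExp]
  ring

lemma hasDerivAt_stretchedExpDeriv (α : ℝ) {z : ℂ} (hz : 0 < z.re) :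
    HasDerivAt (stretchedExpDeriv α) (stretchedExpDeriv₂ α z) z := by
  have hs : z ∈ Complex.slitPlane := Or.inl hz
  have h1 := (((hasDerivAt_id z).cpow_const (c := (α : ℂ) - 1) hs).const_mul (α : ℂ)).neg
  refine (h1.mul (hasDerivAt_stretchedExp α hz)).congr_deriv ?_
  simp [stretchedExpDeriv₂, stretchedExpDeriv]
  ring

lemma differentiableAt_stretchedExpDeriv₂ (α : ℝ) {z : ℂ} (hz : 0 < z.re) :
    DifferentiableAt ℂ (stretchedExpDeriv₂ α) z := by
  have hs : z ∈ Complex.slitPlane := Or.inl hz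
  have h1 : ∀ c : ℂ, DifferentiableAt ℂ (fun z : ℂ => z ^ c) z := fun c =>
    differentiableAt_id.cpow_const hs
  exact (((h1 _).const_mul _).add (((h1 _).const_mul _).pow 2)).mul
    (hasDerivAt_stretchedExp α hz).differentiableAt

lemma cos_pi_div_two_mul_pos {α : ℝ} (hα : α ∈ Ioo (0:ℝ) 1) : 0 < Real.cos (Real.pi / 2 * α) := by
  have := Real.pi_pos
  apply Real.cos_pos_of_mem_Ioo
  constructor <;> nlinarith [hα.1, hα.2]

lemma norm_stretchedExp_le {α : ℝ} (hα : α ∈ Ioo (0:ℝ) 1) {z : ℂ} (hz : 0 < z.re) :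
    ‖stretchedExp α z‖ ≤ Real.exp (-(Real.cos (Real.pi / 2 * α) * ‖z‖ ^ α)) := by
  rw [stretchedExp, Complex.norm_exp, Complex.neg_re, Complex.cpow_ofReal_re, mul_comm (‖z‖ ^ α)]
  have harg : |z.arg| ≤ Real.pi / 2 := Complex.abs_arg_le_pi_div_two_iff.2 hz.le
  have hcos : Real.cos (Real.pi / 2 * α) ≤ Real.cos (z.arg * α) := by
    rw [← Real.cos_abs (z.arg * α), abs_mul, abs_of_pos hα.1]
    apply Real.cos_le_cos_of_nonneg_of_le_pi
    · exact mul_nonneg (abs_nonneg _) hα.1.le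
    · nlinarith [hα.1, hα.2, Real.pi_pos]
    · exact mul_le_mul_of_nonneg_right harg hα.1.le
  gcongr

/-- `φ` is holomorphic on the right half-plane and decays like `|z| ^ (α - 2) exp (-c |z| ^ α)`. -/
structure StretchedDecay (α c M : ℝ) (φ : ℂ → ℂ) : Prop where
  diff : ∀ z : ℂ, 0 < z.re → DifferentiableAt ℂ φ z
  bound : ∀ z : ℂ, 0 < z.re → ‖φ z‖ ≤ M * (‖z‖ ^ (α - 2) * Real.exp (-(c * ‖z‖ ^ α)))

lemma exists_stretchedDecay {α : ℝ} (hα : α ∈ Ioo (0:ℝ) 1) :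
    ∃ c M : ℝ, 0 < c ∧ 0 < M ∧ StretchedDecay α c M (stretchedExp α) ∧
      StretchedDecay α c M (stretchedExpDeriv α) ∧
      StretchedDecay α c M (stretchedExpDeriv₂ α) := by
  have h0 := cos_pi_div_two_mul_pos hα
  set c₀ := Real.cos (Real.pi / 2 * α)
  have hc : 0 < c₀ / 2 := by positivity
  obtain ⟨A, hA, hA'⟩ := exists_rpow_mul_exp_neg_le hα.1 hc (p := 2 - α) (by linarith [hα.2])
  obtain ⟨B, hB, hB'⟩ := exists_rpow_mul_exp_neg_le hα.1 hc one_pos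
  obtain ⟨D, hD, hD'⟩ := exists_rpow_mul_exp_neg_le hα.1 hc hα.1
  have key : ∀ (p N : ℝ) (z : ℂ), 0 < z.re →
      ‖z‖ ^ p * Real.exp (-(c₀ / 2 * ‖z‖ ^ α)) ≤ N →
      ‖z‖ ^ (α - 2 + p) * ‖stretchedExp α z‖ ≤
        N * (‖z‖ ^ (α - 2) * Real.exp (-(c₀ / 2 * ‖z‖ ^ α))) := by
    intro p N z hz hN
    have hz' : 0 < ‖z‖ := norm_pos_iff.2 (by rintro rfl; simp at hz)
    calc ‖z‖ ^ (α - 2 + p) * ‖stretchedExp α z‖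
        ≤ ‖z‖ ^ (α - 2 + p) * Real.exp (-(c₀ * ‖z‖ ^ α)) := by
          gcongr
          exact norm_stretchedExp_le hα hz
      _ = (‖z‖ ^ p * Real.exp (-(c₀ / 2 * ‖z‖ ^ α))) *
            (‖z‖ ^ (α - 2) * Real.exp (-(c₀ / 2 * ‖z‖ ^ α))) := by
          rw [Real.rpow_add hz', show -(c₀ * ‖z‖ ^ α) =
            -(c₀ / 2 * ‖z‖ ^ α) + -(c₀ / 2 * ‖z‖ ^ α) by ring, Real.exp_add]
          ring
      _ ≤ _ := by gcongr
  have hn : ∀ z : ℂ, ‖z ^ ((α : ℂ) - 1)‖ = ‖z‖ ^ (α - 1) := fun z => by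
    rw [← Complex.norm_cpow_real]; push_cast; rfl
  have hpos : ∀ z : ℂ, 0 ≤ ‖z‖ ^ (α - 2) * Real.exp (-(c₀ / 2 * ‖z‖ ^ α)) := fun z => by
    positivity
  refine ⟨c₀ / 2, A + B + D + 1, hc, by positivity, ⟨?_, ?_⟩, ⟨?_, ?_⟩, ⟨?_, ?_⟩⟩
  · exact fun z hz => (hasDerivAt_stretchedExp α hz).differentiableAt
  · intro z hz
    have hz' : 0 < ‖z‖ := norm_pos_iff.2 (by rintro rfl; simp at hz)
    have := key (2 - α) A z hz (hA' _ hz')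
    rw [show α - 2 + (2 - α) = 0 by ring, Real.rpow_zero, one_mul] at this
    refine this.trans (mul_le_mul_of_nonneg_right (by linarith) (hpos z))
  · exact fun z hz => (hasDerivAt_stretchedExpDeriv α hz).differentiableAt
  · intro z hz
    have hz' : 0 < ‖z‖ := norm_pos_iff.2 (by rintro rfl; simp at hz)
    have := key 1 B z hz (hB' _ hz')
    rw [show α - 2 + 1 = α - 1 by ring] at this
    rw [stretchedExpDeriv, norm_mul, norm_neg, norm_mul, Complex.norm_real,
      Real.norm_of_nonneg hα.1.le, hn z, mul_assoc]
    refine (mul_le_of_le_one_left (by positivity) hα.2.le).trans (this.trans ?_)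
    exact mul_le_mul_of_nonneg_right (by linarith) (hpos z)
  · exact fun z hz => differentiableAt_stretchedExpDeriv₂ α hz
  · intro z hz
    have hz' : 0 < ‖z‖ := norm_pos_iff.2 (by rintro rfl; simp at hz)
    have h1 := key α D z hz (hD' _ hz')
    have h2 : ‖z‖ ^ (α - 2) * ‖stretchedExp α z‖ ≤
        1 * (‖z‖ ^ (α - 2) * Real.exp (-(c₀ / 2 * ‖z‖ ^ α))) := by
      have := key 0 1 z hz (by
        rw [Real.rpow_zero, one_mul, Real.exp_le_one_iff]
        have : 0 ≤ c₀ / 2 * ‖z‖ ^ α := by positivity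
        linarith)
      simpa using this
    have hn2 : ‖z ^ ((α : ℂ) - 1 - 1)‖ = ‖z‖ ^ (α - 2) := by
      rw [← Complex.norm_cpow_real]; push_cast; congr 2; ring
    have ha : ‖(α : ℂ) * (1 - α)‖ ≤ 1 := by
      rw [show (α : ℂ) * (1 - α) = ((α * (1 - α) : ℝ) : ℂ) by push_cast; rfl,
        Complex.norm_real, Real.norm_of_nonneg (mul_nonneg hα.1.le (by linarith [hα.2]))]
      nlinarith [hα.1, hα.2]
    have ha2 : ‖(α : ℂ)‖ ^ 2 ≤ 1 := by
      rw [Complex.norm_real, Real.norm_of_nonneg hα.1.le]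
      nlinarith [hα.1, hα.2]
    have hsq : (‖z‖ ^ (α - 1)) ^ 2 = ‖z‖ ^ (α - 2 + α) := by
      rw [← Real.rpow_natCast, ← Real.rpow_mul hz'.le]
      congr 1
      push_cast
      ring
    rw [stretchedExpDeriv₂, norm_mul]
    calc _ ≤ (1 * ‖z‖ ^ (α - 2) + 1 * ‖z‖ ^ (α - 2 + α)) * ‖stretchedExp α z‖ := by
          gcongr
          refine (norm_add_le _ _).trans ?_
          rw [norm_mul ((α : ℂ) * (1 - α)), norm_pow, norm_mul (α : ℂ) (z ^ _), hn z, hn2, mul_pow, hsq]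
          gcongr
      _ = ‖z‖ ^ (α - 2) * ‖stretchedExp α z‖ + ‖z‖ ^ (α - 2 + α) * ‖stretchedExp α z‖ := by ring
      _ ≤ _ := add_le_add h2 h1
      _ = (1 + D) * (‖z‖ ^ (α - 2) * Real.exp (-(c₀ / 2 * ‖z‖ ^ α))) := by ring
      _ ≤ _ := mul_le_mul_of_nonneg_right (by linarith) (hpos z)

/-- The integral of `exp (s z) φ z` along the vertical line `Re z = x`, with respect to `Im z`. -/
def lineIntegral (φ : ℂ → ℂ) (s x : ℝ) : ℂ :=
  ∫ y : ℝ, Complex.exp (s * (x + y * Complex.I)) * φ (x + y * Complex.I)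

/-- The integral `∫ (1 + y²) ^ ((α - 2) / 2) dy`. -/
def japaneseIntegral (α : ℝ) : ℝ := ∫ y : ℝ, ((1:ℝ) + ‖y‖ ^ 2) ^ (-(2 - α) / 2)

lemma integrable_japanese {α : ℝ} (hα : α < 1) :
    Integrable fun y : ℝ => ((1:ℝ) + ‖y‖ ^ 2) ^ (-(2 - α) / 2) :=
  integrable_rpow_neg_one_add_norm_sq (by simp; linarith)

lemma re_add_mul_I (x y : ℝ) : ((x : ℂ) + y * Complex.I).re = x := by simp

lemma norm_exp_mul_add_mul_I (s x y : ℝ) :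
    ‖Complex.exp (s * ((x : ℂ) + y * Complex.I))‖ = Real.exp (s * x) := by
  simp [Complex.norm_exp]

lemma norm_add_mul_I_sq (x y : ℝ) : ‖(x : ℂ) + y * Complex.I‖ ^ 2 = x ^ 2 + y ^ 2 := by
  rw [← Complex.normSq_eq_norm_sq, Complex.normSq_add_mul_I]

namespace StretchedDecay

variable {α c M : ℝ} {φ : ℂ → ℂ}

lemma continuous_line (h : StretchedDecay α c M φ) {x : ℝ} (hx : 0 < x) :
    Continuous fun y : ℝ => φ (x + y * Complex.I) := by
  refine continuous_iff_continuousAt.2 fun y => ?_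
  exact ContinuousAt.comp (f := fun y : ℝ => (x : ℂ) + y * Complex.I)
    (h.diff _ (by simpa using hx)).continuousAt (by fun_prop)

lemma norm_line_le (h : StretchedDecay α c M φ) (hα : α ∈ Ioo (0:ℝ) 1) (hc : 0 < c) (hM : 0 < M)
    (s : ℝ) {x : ℝ} (hx : 0 < x) (y : ℝ) :
    ‖Complex.exp (s * (x + y * Complex.I)) * φ (x + y * Complex.I)‖ ≤
      M * Real.exp (s * x - c * x ^ α) * x ^ (α - 2) *
        ((1:ℝ) + ‖y / x‖ ^ 2) ^ (-(2 - α) / 2) := by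
  have hb := h.bound (x + y * Complex.I) (by simpa using hx)
  have hxz : x ≤ ‖(x : ℂ) + y * Complex.I‖ := by
    simpa using (Complex.re_le_norm ((x : ℂ) + y * Complex.I))
  have hpow : ‖(x : ℂ) + y * Complex.I‖ ^ (α - 2) =
      x ^ (α - 2) * ((1:ℝ) + ‖y / x‖ ^ 2) ^ (-(2 - α) / 2) := by
    have h2 : ∀ t : ℝ, 0 ≤ t → t ^ (α - 2) = (t ^ 2) ^ (-(2 - α) / 2) := fun t ht => by
      rw [← Real.rpow_natCast, ← Real.rpow_mul ht]
      congr 1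
      push_cast
      ring
    rw [h2 _ (norm_nonneg _), h2 _ hx.le, ← Real.mul_rpow (by positivity) (by positivity),
      norm_add_mul_I_sq, Real.norm_eq_abs, sq_abs]
    congr 1
    field_simp
  rw [norm_mul, norm_exp_mul_add_mul_I]
  calc _ ≤ Real.exp (s * x) * (M * (‖(x : ℂ) + y * Complex.I‖ ^ (α - 2) *
        Real.exp (-(c * x ^ α)))) := by
        gcongr
        refine hb.trans ?_
        gcongr
        exact hα.1.le
    _ = _ := by
        rw [hpow, sub_eq_add_neg (s * x), Real.exp_add]
        ring

lemma integrable_line (h : StretchedDecay α c M φ) (hα : α ∈ Ioo (0:ℝ) 1) (hc : 0 < c)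
    (hM : 0 < M) (s : ℝ) {x : ℝ} (hx : 0 < x) :
    Integrable fun y : ℝ => Complex.exp (s * (x + y * Complex.I)) * φ (x + y * Complex.I) := by
  refine Integrable.mono' (((integrable_japanese hα.2).comp_div hx.ne').const_mul
    (M * Real.exp (s * x - c * x ^ α) * x ^ (α - 2))) ?_
    (ae_of_all _ (h.norm_line_le hα hc hM s hx))
  exact ((by fun_prop : Continuous fun y : ℝ => Complex.exp (s * (x + y * Complex.I))).mul
    (h.continuous_line hx)).aestronglyMeasurable

lemma norm_lineIntegral_le (h : StretchedDecay α c M φ) (hα : α ∈ Ioo (0:ℝ) 1) (hc : 0 < c)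
    (hM : 0 < M) (s : ℝ) {x : ℝ} (hx : 0 < x) :
    ‖lineIntegral φ s x‖ ≤
      M * japaneseIntegral α * (x ^ (α - 1) * Real.exp (s * x - c * x ^ α)) := by
  refine (norm_integral_le_of_norm_le (((integrable_japanese hα.2).comp_div hx.ne').const_mul
    (M * Real.exp (s * x - c * x ^ α) * x ^ (α - 2)))
    (ae_of_all _ (h.norm_line_le hα hc hM s hx))).trans_eq ?_
  rw [integral_const_mul, Measure.integral_comp_div
    (fun y : ℝ => ((1:ℝ) + ‖y‖ ^ 2) ^ (-(2 - α) / 2)) x, abs_of_pos hx, smul_eq_mul,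
    japaneseIntegral, show α - 1 = α - 2 + 1 by ring, Real.rpow_add_one hx.ne']
  ring

lemma continuous_lineIntegral (h : StretchedDecay α c M φ) (hα : α ∈ Ioo (0:ℝ) 1) (hc : 0 < c)
    (hM : 0 < M) {x : ℝ} (hx : 0 < x) : Continuous fun s => lineIntegral φ s x := by
  refine continuous_iff_continuousAt.2 fun s₀ => ?_
  refine continuousAt_of_dominated
    (bound := fun y => Real.exp ((|s₀| + 1) * x) * ‖φ (x + y * Complex.I)‖)
    (Eventually.of_forall fun s => (h.integrable_line hα hc hM s hx).aestronglyMeasurable)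
    ?_ ?_ (ae_of_all _ fun y => by fun_prop)
  · filter_upwards [Metric.ball_mem_nhds s₀ one_pos] with s hs
    refine ae_of_all _ fun y => ?_
    rw [norm_mul, norm_exp_mul_add_mul_I]
    gcongr
    rw [Metric.mem_ball, Real.dist_eq] at hs
    have := abs_sub_abs_le_abs_sub s s₀
    linarith [le_abs_self s]
  · have := h.integrable_line hα hc hM 0 hx
    simp only [Complex.ofReal_zero, zero_mul, Complex.exp_zero, one_mul] at this
    exact this.norm.const_mul _

lemma lineIntegral_deriv {ψ : ℂ → ℂ} (h : StretchedDecay α c M φ) (h' : StretchedDecay α c M ψ)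
    (hd : ∀ z : ℂ, 0 < z.re → HasDerivAt φ (ψ z) z) (hα : α ∈ Ioo (0:ℝ) 1) (hc : 0 < c)
    (hM : 0 < M) (s : ℝ) {x : ℝ} (hx : 0 < x) :
    lineIntegral ψ s x = -(s * lineIntegral φ s x) := by
  have i1 := h.integrable_line hα hc hM s hx
  have i2 := h'.integrable_line hα hc hM s hx
  have hder : ∀ y : ℝ, HasDerivAt
      (fun y : ℝ => Complex.exp (s * (x + y * Complex.I)) * φ (x + y * Complex.I))
      (Complex.I * (s * (Complex.exp (s * (x + y * Complex.I)) * φ (x + y * Complex.I)) +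
        Complex.exp (s * (x + y * Complex.I)) * ψ (x + y * Complex.I))) y := by
    intro y
    have hl : HasDerivAt (fun y : ℝ => (x : ℂ) + y * Complex.I) Complex.I y := by
      simpa using ((Complex.ofRealCLM.hasDerivAt (x := y)).mul_const Complex.I).const_add (x : ℂ)
    have h1 := (hl.const_mul (s : ℂ)).cexp
    have h2 := (hd (x + y * Complex.I) (by simpa using hx)).comp_of_eq y hl rfl
    refine (h1.mul h2).congr_deriv ?_
    simp only [Function.comp_apply]
    ring
  have := integral_eq_zero_of_hasDerivAt_of_integrable hder
    (((i1.const_mul _).add i2).const_mul _) i1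
  rw [integral_const_mul, integral_add (i1.const_mul _) i2, integral_const_mul,
    mul_eq_zero, or_iff_right Complex.I_ne_zero] at this
  rw [lineIntegral, lineIntegral]
  linear_combination this

lemma norm_le_of_le_abs_im (h : StretchedDecay α c M φ) (hα : α ∈ Ioo (0:ℝ) 1) (hc : 0 < c)
    (hM : 0 < M) {z : ℂ} (hz : 0 < z.re) {T : ℝ} (hT : 0 < T) (hzT : T ≤ |z.im|) :
    ‖φ z‖ ≤ M * T ^ (-(2 - α)) := by
  refine (h.bound z hz).trans ?_
  gcongr
  have h1 : T ≤ ‖z‖ := hzT.trans (Complex.abs_im_le_norm z)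
  have h2 : 0 ≤ c * ‖z‖ ^ α := by positivity
  calc ‖z‖ ^ (α - 2) * Real.exp (-(c * ‖z‖ ^ α)) ≤ ‖z‖ ^ (α - 2) :=
        mul_le_of_le_one_right (by positivity) (Real.exp_le_one_iff.2 (by linarith))
    _ ≤ T ^ (-(2 - α)) := by
        rw [neg_sub]
        exact Real.rpow_le_rpow_of_nonpos hT h1 (by linarith [hα.2])

lemma lineIntegral_eq (h : StretchedDecay α c M φ) (hα : α ∈ Ioo (0:ℝ) 1) (hc : 0 < c)
    (hM : 0 < M) (s : ℝ) {a b : ℝ} (ha : 0 < a) (hb : 0 < b) :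
    lineIntegral φ s a = lineIntegral φ s b := by
  set Φ : ℂ → ℂ := fun z => Complex.exp (s * z) * φ z with hΦ
  have hre : ∀ x ∈ uIcc a b, 0 < x := fun x hx => (lt_min ha hb).trans_le hx.1
  have hrect : ∀ T : ℝ, (∫ x : ℝ in a..b, Φ (x + (-T : ℝ) * Complex.I)) -
      (∫ x : ℝ in a..b, Φ (x + T * Complex.I)) +
      Complex.I * (∫ y : ℝ in (-T)..T, Φ (b + y * Complex.I)) -
      Complex.I * (∫ y : ℝ in (-T)..T, Φ (a + y * Complex.I)) = 0 := by
    intro T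
    have := Complex.integral_boundary_rect_eq_zero_of_differentiableOn Φ ⟨a, -T⟩ ⟨b, T⟩ ?_
    · simpa only [smul_eq_mul] using this
    · intro z hz
      have hz0 : 0 < z.re := hre _ hz.1
      exact ((by fun_prop : DifferentiableAt ℂ (fun z : ℂ => Complex.exp (s * z)) z).mul
        (h.diff z hz0)).differentiableWithinAt
  have hlim : ∀ x : ℝ, 0 < x → Tendsto (fun T : ℝ => ∫ y : ℝ in (-T)..T, Φ (x + y * Complex.I))
      atTop (𝓝 (lineIntegral φ s x)) := fun x hx =>
    intervalIntegral_tendsto_integral (h.integrable_line hα hc hM s hx)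
      tendsto_neg_atTop_atBot tendsto_id
  have hhor : ∀ ε : ℝ, |ε| = 1 → Tendsto
      (fun T : ℝ => ∫ x : ℝ in a..b, Φ (x + (ε * T : ℝ) * Complex.I)) atTop (𝓝 0) := by
    intro ε hε
    have ht : Tendsto (fun T : ℝ => Real.exp (|s| * max a b) * (M * T ^ (-(2 - α))) * |b - a|)
        atTop (𝓝 0) := by
      simpa using (((tendsto_rpow_neg_atTop (show 0 < 2 - α by linarith [hα.2])).const_mul
        M).const_mul (Real.exp (|s| * max a b))).mul_const |b - a|
    refine squeeze_zero_norm' ?_ ht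
    filter_upwards [eventually_gt_atTop 0] with T hT
    refine intervalIntegral.norm_integral_le_of_norm_le_const fun x hx => ?_
    have hx' := uIoc_subset_uIcc hx
    have hx0 := hre x hx'
    rw [hΦ, norm_mul, norm_exp_mul_add_mul_I]
    gcongr
    · exact le_abs_self s
    · exact hx'.2
    · exact h.norm_le_of_le_abs_im hα hc hM (by simpa using hx0) hT
        (by simp [abs_mul, hε, abs_of_pos hT])
  have h1 := hhor 1 (by simp)
  have h2 := hhor (-1) (by simp)
  simp only [one_mul, neg_one_mul] at h1 h2
  have := ((h2.sub h1).add ((hlim b hb).const_mul Complex.I)).sub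
    ((hlim a ha).const_mul Complex.I)
  have h0 := tendsto_nhds_unique this (tendsto_const_nhds.congr fun T => (hrect T).symm)
  have h3 : Complex.I * (lineIntegral φ s b - lineIntegral φ s a) = 0 := by
    linear_combination h0
  rw [mul_eq_zero, or_iff_right Complex.I_ne_zero, sub_eq_zero] at h3
  exact h3.symm

/-- Bromwich inversion: the normalised line integral of `φ` has bilateral Laplace
transform `φ`. -/
lemma integral_exp_neg_mul_lineIntegral (h : StretchedDecay α c M φ) (hα : α ∈ Ioo (0:ℝ) 1)
    (hc : 0 < c) (hM : 0 < M) {x : ℝ} (hx : 0 < x) (y : ℝ)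
    (hint : Integrable fun s : ℝ => (Real.exp (-(s * x)) : ℂ) * lineIntegral φ s x) :
    ∫ s : ℝ, Complex.exp (-(s : ℂ) * (x + y * Complex.I)) *
      (((2 * Real.pi)⁻¹ : ℝ) * lineIntegral φ s x) = φ (x + y * Complex.I) := by
  have h2π : (0:ℝ) < 2 * Real.pi := by positivity
  set ψ : ℝ → ℂ := fun v => φ (x + (2 * Real.pi * v : ℝ) * Complex.I) with hψ
  have hψc : Continuous ψ := (h.continuous_line hx).comp (by fun_prop)
  have hψi : Integrable ψ := by
    have := h.integrable_line hα hc hM 0 hx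
    simp only [Complex.ofReal_zero, zero_mul, Complex.exp_zero, one_mul] at this
    exact this.comp_mul_left' h2π.ne'
  have hinv : ∀ s, FourierTransformInv.fourierInv ψ s =
      ((2 * Real.pi)⁻¹ : ℝ) * ((Real.exp (-(s * x)) : ℂ) * lineIntegral φ s x) := by
    intro s
    have hsc := Measure.integral_comp_mul_left (fun y : ℝ => (Real.exp (-(s * x)) : ℂ) *
      (Complex.exp (s * (x + y * Complex.I)) * φ (x + y * Complex.I))) (2 * Real.pi)
    rw [abs_of_pos (inv_pos.2 h2π), integral_const_mul (_ : ℂ)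
      fun y : ℝ => Complex.exp (s * (x + y * Complex.I)) * φ (x + y * Complex.I)] at hsc
    rw [Real.fourierInv_eq', lineIntegral]
    refine Eq.trans ?_ (hsc.trans ?_)
    · refine integral_congr_ae (ae_of_all _ fun v => ?_)
      simp only
      rw [hψ, smul_eq_mul, ← mul_assoc, Complex.ofReal_exp, ← Complex.exp_add]
      congr 2
      simp
      ring
    · rw [Complex.real_smul]
  have hfi : Integrable (FourierTransform.fourier ψ) := by
    have : Integrable (FourierTransformInv.fourierInv ψ) :=
      (hint.const_mul (((2 * Real.pi)⁻¹ : ℝ) : ℂ)).congr (ae_of_all _ fun s => (hinv s).symm)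
    refine this.comp_neg.congr (ae_of_all _ fun s => ?_)
    simp [Real.fourierInv_eq_fourier_neg]
  have key := congrFun (hψc.fourier_fourierInv_eq hψi hfi) (y / (2 * Real.pi))
  rw [hψ] at key
  simp only [mul_div_cancel₀ _ h2π.ne'] at key
  rw [← key, Real.fourier_eq']
  congr 1
  ext s
  rw [← hψ, hinv, smul_eq_mul, Complex.ofReal_exp, mul_left_comm (((2 * Real.pi)⁻¹ : ℝ) : ℂ),
    ← mul_assoc (Complex.exp _) (Complex.exp _), ← Complex.exp_add]
  congr 2
  simp
  field_simp
  ring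

end StretchedDecay

lemma stretchedExp_conj (α : ℝ) {z : ℂ} (hz : 0 < z.re) :
    stretchedExp α (starRingEnd ℂ z) = starRingEnd ℂ (stretchedExp α z) := by
  have hs : z.arg ≠ Real.pi := (Complex.mem_slitPlane_iff_arg.1 (Or.inl hz)).1
  rw [stretchedExp, stretchedExp, ← Complex.exp_conj, map_neg, Complex.conj_cpow _ _ hs,
    Complex.conj_ofReal]

lemma conj_lineIntegral_stretchedExp (α s : ℝ) {x : ℝ} (hx : 0 < x) :
    starRingEnd ℂ (lineIntegral (stretchedExp α) s x) = lineIntegral (stretchedExp α) s x := by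
  rw [lineIntegral, ← integral_conj, ← integral_neg_eq_self]
  refine integral_congr_ae (ae_of_all _ fun y => ?_)
  have h : starRingEnd ℂ ((x : ℂ) + (-y : ℝ) * Complex.I) = x + y * Complex.I := by
    simp
  simp only
  rw [map_mul, ← Complex.exp_conj, ← stretchedExp_conj α (by simpa using hx), map_mul, h,
    Complex.conj_ofReal]

/-- The density of the one-sided `α`-stable law, as a Bromwich integral. -/
def stableDensity (α s : ℝ) : ℝ :=
  (2 * Real.pi)⁻¹ * (lineIntegral (stretchedExp α) s 1).re

lemma stableDensity_eq {α c M : ℝ} (hα : α ∈ Ioo (0:ℝ) 1) (hc : 0 < c) (hM : 0 < M)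
    (h : StretchedDecay α c M (stretchedExp α)) (s : ℝ) {x : ℝ} (hx : 0 < x) :
    (stableDensity α s : ℂ) = ((2 * Real.pi)⁻¹ : ℝ) * lineIntegral (stretchedExp α) s x := by
  rw [h.lineIntegral_eq hα hc hM s hx one_pos, stableDensity, Complex.ofReal_mul,
    Complex.conj_eq_iff_re.1 (conj_lineIntegral_stretchedExp α s one_pos)]

lemma continuous_stableDensity {α : ℝ} (hα : α ∈ Ioo (0:ℝ) 1) : Continuous (stableDensity α) := by
  obtain ⟨c, M, hc, hM, h, -⟩ := exists_stretchedDecay hα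
  exact continuous_const.mul (Complex.continuous_re.comp
    (h.continuous_lineIntegral hα hc hM one_pos))

/-- Saddle-type bounds for the stable density, with a free abscissa `x`. -/
lemma exists_abs_stableDensity_le {α : ℝ} (hα : α ∈ Ioo (0:ℝ) 1) :
    ∃ K c : ℝ, 0 < K ∧ 0 < c ∧ ∀ s x : ℝ, 0 < x →
      |stableDensity α s| ≤ K * (x ^ (α - 1) * Real.exp (s * x - c * x ^ α)) ∧
      s ^ 2 * |stableDensity α s| ≤ K * (x ^ (α - 1) * Real.exp (s * x - c * x ^ α)) := by
  obtain ⟨c, M, hc, hM, h, h1, h2⟩ := exists_stretchedDecay hα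
  have hJ : 0 ≤ japaneseIntegral α := integral_nonneg fun y => by positivity
  have hπ : 0 ≤ (2 * Real.pi)⁻¹ := by positivity
  refine ⟨(2 * Real.pi)⁻¹ * (M * japaneseIntegral α) + 1, c, by positivity, hc,
    fun s x hx => ?_⟩
  have hn : |stableDensity α s| =
      (2 * Real.pi)⁻¹ * ‖lineIntegral (stretchedExp α) s x‖ := by
    rw [← Real.norm_eq_abs, ← Complex.norm_real, stableDensity_eq hα hc hM h s hx, norm_mul,
      Complex.norm_real, Real.norm_of_nonneg hπ]
  have hs : s ^ 2 * ‖lineIntegral (stretchedExp α) s x‖ =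
      ‖lineIntegral (stretchedExpDeriv₂ α) s x‖ := by
    rw [h1.lineIntegral_deriv h2 (fun z => hasDerivAt_stretchedExpDeriv α) hα hc hM s hx,
      h.lineIntegral_deriv h1 (fun z => hasDerivAt_stretchedExp α) hα hc hM s hx]
    simp only [norm_mul, mul_neg, neg_neg, Complex.norm_real, Real.norm_eq_abs]
    rw [← mul_assoc, abs_mul_abs_self, sq]
  have hE : 0 ≤ x ^ (α - 1) * Real.exp (s * x - c * x ^ α) := by positivity
  have hfin : ∀ t : ℝ, t ≤ M * japaneseIntegral α * (x ^ (α - 1) * Real.exp (s * x - c * x ^ α)) →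
      (2 * Real.pi)⁻¹ * t ≤ ((2 * Real.pi)⁻¹ * (M * japaneseIntegral α) + 1) *
        (x ^ (α - 1) * Real.exp (s * x - c * x ^ α)) := fun t ht => by
    have := mul_le_mul_of_nonneg_left ht hπ
    linarith
  refine ⟨hn ▸ hfin _ (h.norm_lineIntegral_le hα hc hM s hx), ?_⟩
  rw [hn, mul_left_comm, hs]
  exact hfin _ (h2.norm_lineIntegral_le hα hc hM s hx)

lemma stableDensity_eq_zero {α : ℝ} (hα : α ∈ Ioo (0:ℝ) 1) {s : ℝ} (hs : s ≤ 0) :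
    stableDensity α s = 0 := by
  obtain ⟨K, c, hK, hc, hb⟩ := exists_abs_stableDensity_le hα
  have ht : Tendsto (fun x : ℝ => K * x ^ (-(1 - α))) atTop (𝓝 0) := by
    simpa using (tendsto_rpow_neg_atTop (show 0 < 1 - α by linarith [hα.2])).const_mul K
  have := ge_of_tendsto ht (b := |stableDensity α s|) ?_
  · exact abs_eq_zero.1 (le_antisymm this (abs_nonneg _))
  · filter_upwards [eventually_gt_atTop 0] with x hx
    refine (hb s x hx).1.trans ?_
    rw [neg_sub]
    gcongr
    refine mul_le_of_le_one_right (by positivity) (Real.exp_le_one_iff.2 ?_)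
    have h1 : s * x ≤ 0 := mul_nonpos_of_nonpos_of_nonneg hs hx.le
    have h2 : 0 ≤ c * x ^ α := by positivity
    linarith

lemma integrable_cexp_mul_stableDensity {α : ℝ} (hα : α ∈ Ioo (0:ℝ) 1) {z : ℂ} (hz : 0 < z.re) :
    Integrable fun s : ℝ => Complex.exp (-(s : ℂ) * z) * (stableDensity α s : ℂ) := by
  obtain ⟨K, c, hK, hc, hb⟩ := exists_abs_stableDensity_le hα
  have hx : 0 < z.re / 2 := by positivity
  rw [← integrableOn_iff_integrable_of_support_subset (s := Ioi 0)]
  · have hmajor : IntegrableOn (fun s : ℝ => K * (z.re / 2) ^ (α - 1) *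
        Real.exp (-(z.re / 2) * s)) (Ioi 0) := (exp_neg_integrableOn_Ioi 0 hx).const_mul _
    refine hmajor.mono' ?_ (ae_of_all _ fun s => ?_)
    · have := continuous_stableDensity hα
      exact Continuous.aestronglyMeasurable (by fun_prop)
    · rw [norm_mul, Complex.norm_exp, Complex.norm_real, Real.norm_eq_abs]
      have h0 : 0 ≤ c * (z.re / 2) ^ α := by positivity
      calc Real.exp (-(s : ℂ) * z).re * |stableDensity α s|
          ≤ Real.exp (-(s : ℂ) * z).re *
            (K * ((z.re / 2) ^ (α - 1) * Real.exp (s * (z.re / 2)))) := by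
            gcongr
            refine (hb s _ hx).1.trans ?_
            gcongr
            linarith
        _ = _ := by
            have : (-(s : ℂ) * z).re = -(z.re / 2) * s + -(s * (z.re / 2)) := by
              simp; ring
            rw [this, Real.exp_add, Real.exp_neg (s * (z.re / 2))]
            field_simp
  · intro s hs
    by_contra h
    exact hs (by simp [stableDensity_eq_zero hα (not_lt.1 h)])

lemma integral_cexp_mul_stableDensity {α : ℝ} (hα : α ∈ Ioo (0:ℝ) 1) {z : ℂ} (hz : 0 < z.re) :
    ∫ s in Ioi (0:ℝ), Complex.exp (-(s : ℂ) * z) * (stableDensity α s : ℂ) =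
      stretchedExp α z := by
  obtain ⟨c, M, hc, hM, h, -⟩ := exists_stretchedDecay hα
  rw [setIntegral_eq_integral_of_forall_compl_eq_zero
    (fun s hs => by simp [stableDensity_eq_zero hα (not_lt.1 hs)])]
  have hint : Integrable fun s : ℝ =>
      (Real.exp (-(s * z.re)) : ℂ) * lineIntegral (stretchedExp α) s z.re := by
    have := (integrable_cexp_mul_stableDensity hα (z := z.re) (by simpa using hz)).const_mul
      ((2 * Real.pi : ℝ) : ℂ)
    refine this.congr (ae_of_all _ fun s => ?_)
    have hπ : ((2 * Real.pi : ℝ) : ℂ) ≠ 0 :=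
      Complex.ofReal_ne_zero.2 (mul_pos two_pos Real.pi_pos).ne'
    simp only
    rw [stableDensity_eq hα hc hM h s hz, Complex.ofReal_inv]
    field_simp
    push_cast
    ring_nf
  have key := h.integral_exp_neg_mul_lineIntegral hα hc hM hz z.im hint
  rw [Complex.re_add_im] at key
  rw [← key]
  congr 1
  ext s
  rw [stableDensity_eq hα hc hM h s hz]

lemma stableDensity_nonneg {α : ℝ} (hα : α ∈ Ioo (0:ℝ) 1) {s : ℝ} (hs : 0 < s) :
    0 ≤ stableDensity α s := by
  obtain ⟨K, c, hK, hc, hb⟩ := exists_abs_stableDensity_le hα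
  refine nonneg_of_laplace_iterDiff_nonneg
    (u := fun y => y ^ (-(0:ℝ)) * Real.exp (-y ^ α)) (C := K)
    (continuous_stableDensity hα) (fun t _ => ?_) (fun x hx => ?_)
    (fun n x hx => iterDiff_rpow_mul_exp_nonneg hα n le_rfl (by linarith)) hs
  · refine (hb t 1 one_pos).1.trans ?_
    rw [Real.one_rpow, Real.one_rpow, one_mul]
    gcongr
    linarith
  · have hx0 : 0 < x := by linarith
    have := integral_cexp_mul_stableDensity hα (z := x) (by simpa using hx0)
    apply Complex.ofReal_injective
    rw [← integral_complex_ofReal]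
    simp only [neg_zero, Real.rpow_zero, one_mul]
    rw [Complex.ofReal_exp, Complex.ofReal_neg, Complex.ofReal_cpow hx0.le]
    rw [stretchedExp] at this
    rw [← this]
    congr 1
    ext s
    push_cast
    ring_nf

lemma exists_mul_stableDensity_le {α : ℝ} (hα : α ∈ Ioo (0:ℝ) 1) :
    ∃ C c : ℝ, 0 < C ∧ 0 < c ∧ ∀ s : ℝ, 0 < s →
      s * stableDensity α s ≤ C * s ^ (-α) * Real.exp (-c * s ^ (-(α / (1 - α)))) := by
  obtain ⟨K, c, hK, hc, hb⟩ := exists_abs_stableDensity_le hα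
  have hα' : 0 < 1 - α := by linarith [hα.2]
  set k := c / 2 with hk
  have hk0 : 0 < k := by positivity
  set d := k * k ^ (α / (1 - α)) with hd
  have hd0 : 0 < d := by positivity
  have hC1 : K / k ≤ K / k + K * Real.exp (1 + d) := le_add_of_nonneg_right (by positivity)
  have hC2 : K * Real.exp (1 + d) ≤ K / k + K * Real.exp (1 + d) :=
    le_add_of_nonneg_left (by positivity)
  refine ⟨K / k + K * Real.exp (1 + d), d, by positivity, hd0, fun s hs => ?_⟩
  rcases le_total s 1 with h1 | h1
  · set x := (k / s) ^ (1 / (1 - α)) with hx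
    have hx0 : 0 < x := by positivity
    have hxa : x ^ α = k ^ (α / (1 - α)) * s ^ (-(α / (1 - α))) := by
      rw [hx, ← Real.rpow_mul (by positivity), div_mul_eq_mul_div, one_mul,
        Real.div_rpow hk0.le hs.le, Real.rpow_neg hs.le, div_eq_mul_inv]
    have hxp : x ^ (1 - α) = k / s := by
      rw [hx, ← Real.rpow_mul (by positivity), one_div_mul_cancel hα'.ne', Real.rpow_one]
    have hxm : x ^ (α - 1) = s / k := by
      rw [← neg_sub, Real.rpow_neg hx0.le, hxp, inv_div]
    have hsx : s * x = k * x ^ α := by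
      have : x = x ^ (1 - α) * x ^ α := by
        rw [← Real.rpow_add hx0, sub_add_cancel, Real.rpow_one]
      calc s * x = s * (x ^ (1 - α) * x ^ α) := by rw [← this]
        _ = k * x ^ α := by rw [hxp]; field_simp
    have hexp : s * x - c * x ^ α = -d * s ^ (-(α / (1 - α))) := by
      rw [hsx, hxa, hd, show c = 2 * k by rw [hk]; ring]
      ring
    have h2 := (hb s x hx0).2
    rw [hxm, hexp] at h2
    have h3 : s * |stableDensity α s| ≤ K / k * Real.exp (-d * s ^ (-(α / (1 - α)))) := by
      refine le_of_mul_le_mul_left ?_ hs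
      calc s * (s * |stableDensity α s|) = s ^ 2 * |stableDensity α s| := by ring
        _ ≤ _ := h2
        _ = _ := by ring
    have h4 : 1 ≤ s ^ (-α) :=
      Real.one_le_rpow_of_pos_of_le_one_of_nonpos hs h1 (by linarith [hα.1])
    calc s * stableDensity α s ≤ s * |stableDensity α s| := by
          gcongr
          exact le_abs_self _
      _ ≤ K / k * 1 * Real.exp (-d * s ^ (-(α / (1 - α)))) := by rwa [mul_one]
      _ ≤ _ := by gcongr
  · have h2 := (hb s s⁻¹ (inv_pos.2 hs)).2
    rw [mul_inv_cancel₀ hs.ne'] at h2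
    have h0 : 0 ≤ c * s⁻¹ ^ α := by positivity
    have hp : s⁻¹ ^ (α - 1) = s * s ^ (-α) := by
      rw [Real.inv_rpow hs.le, ← Real.rpow_neg hs.le, neg_sub, sub_eq_add_neg,
        Real.rpow_add hs, Real.rpow_one]
    have h3 : s * |stableDensity α s| ≤ K * s ^ (-α) * Real.exp 1 := by
      refine le_of_mul_le_mul_left ?_ hs
      calc s * (s * |stableDensity α s|) = s ^ 2 * |stableDensity α s| := by ring
        _ ≤ _ := h2
        _ ≤ K * (s⁻¹ ^ (α - 1) * Real.exp 1) := by
          gcongr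
          linarith
        _ = _ := by rw [hp]; ring
    have h4 : s ^ (-(α / (1 - α))) ≤ 1 :=
      Real.rpow_le_one_of_one_le_of_nonpos h1 (neg_nonpos.2 (by have := hα.1; positivity))
    calc s * stableDensity α s ≤ s * |stableDensity α s| := by
          gcongr
          exact le_abs_self _
      _ ≤ K * s ^ (-α) * Real.exp 1 := h3
      _ = K * Real.exp (1 + d) * s ^ (-α) * Real.exp (-d * 1) := by
          rw [Real.exp_add, mul_one, Real.exp_neg]
          field_simp
      _ ≤ K * Real.exp (1 + d) * s ^ (-α) * Real.exp (-d * s ^ (-(α / (1 - α)))) := by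
          gcongr ?_ * Real.exp ?_
          nlinarith
      _ ≤ _ := by gcongr

/-- Subordination: for `α ∈ (0,1)` there is a nonnegative kernel `F` with stretched
exponential decay at zero and polynomial-type control such that
`exp(-z^α) = ∫₀^∞ F(s) e^{-sz} ds/s` for `Re z > 0`. -/
theorem statement19 (α : ℝ) (hα : α ∈ Ioo (0:ℝ) 1) :
    ∃ (F : ℝ → ℝ) (C c : ℝ), Measurable F ∧ 0 < C ∧ 0 < c ∧
      (∀ s : ℝ, 0 < s →
        0 ≤ F s ∧ F s ≤ C * s ^ (-α) * Real.exp (-c * s ^ (-(α / (1 - α))))) ∧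
      ∀ z : ℂ, 0 < z.re →
        IntegrableOn (fun s : ℝ => (F s : ℂ) * Complex.exp (-(s : ℂ) * z) / (s : ℂ))
          (Ioi (0:ℝ)) ∧
        Complex.exp (-(z ^ (α : ℂ))) =
          ∫ s in Ioi (0:ℝ), (F s : ℂ) * Complex.exp (-(s : ℂ) * z) / (s : ℂ) := by
  obtain ⟨C, c, hC, hc, hb⟩ := exists_mul_stableDensity_le hα
  refine ⟨fun s => s * stableDensity α s, C, c,
    (continuous_id.mul (continuous_stableDensity hα)).measurable, hC, hc,
    fun s hs => ⟨mul_nonneg hs.le (stableDensity_nonneg hα hs), hb s hs⟩, fun z hz => ?_⟩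
  have heq : ∀ s ∈ Ioi (0:ℝ), Complex.exp (-(s : ℂ) * z) * (stableDensity α s : ℂ) =
      ((s * stableDensity α s : ℝ) : ℂ) * Complex.exp (-(s : ℂ) * z) / (s : ℂ) := by
    intro s hs
    have : (s : ℂ) ≠ 0 := Complex.ofReal_ne_zero.2 (ne_of_gt hs)
    push_cast
    field_simp
  refine ⟨(integrable_cexp_mul_stableDensity hα hz).integrableOn.congr_fun heq
    measurableSet_Ioi, ?_⟩
  rw [← setIntegral_congr_fun measurableSet_Ioi heq, integral_cexp_mul_stableDensity hα hz,
    stretchedExp]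

end
end
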